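/- arXiv:2009.05095 — 3 statements merged into one kernel-verified Lean document; each statement's English description precedes it below -/
import Mathlib

section
/- Let A be a traceless operator on the first k' sites with ‖A‖ = 1, let f : [−1,1] → {z ∈ ℂ : |z| ≤ 1} be a smooth function, and suppose there is a strictly increasing sequence (N_i) of positive integers such that N_i · r_f(N_i) → 0 as i → ∞. Then for all sufficiently large N, (tr(H_N h)/d) · (tr(H_N² A)/d) = (tr(H_N² h)/d) · (tr(H_N A)/d) (both sides are N-independent constants for large N). -/
open Matrix MeasureTheory Filter

/-- The space of operators on a chain of `N` qudits, each of local dimension `dloc`. -/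
abbrev Op (dloc N : ℕ) := Matrix (Fin N → Fin dloc) (Fin N → Fin dloc) ℂ

/-- Cyclic translation of qudit configurations: site `i` of the new configuration carries
the value of site `i - 1` of the old one. -/
def confShift (dloc N : ℕ) : Equiv.Perm (Fin N → Fin dloc) :=
  Equiv.arrowCongr (finRotate N) (Equiv.refl (Fin dloc))

/-- The translation operator `T` on a chain of `N` qudits, as a permutation matrix. -/
noncomputable def Tmat (dloc N : ℕ) : Op dloc N :=
  fun x y => if x = confShift dloc N y then 1 else 0

/-- Extension of an operator on the first `m` sites to the `N`-site chain, by tensoring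
with the identity on the remaining sites (the zero operator if `m > N`). -/
noncomputable def embed (dloc m N : ℕ) (a : Op dloc m) : Op dloc N :=
  if hm : m ≤ N then
    (fun x y => a (fun i => x (Fin.castLE hm i)) (fun i => y (Fin.castLE hm i)) *
      (if ∀ i : Fin N, m ≤ (i : ℕ) → x i = y i then 1 else 0))
  else 0

/-- The translation-invariant Hamiltonian `H_N = ∑_{l=0}^{N-1} T^l h T^{-l}` built from
a local term `h` on `k` sites. -/
noncomputable def Ham (dloc k N : ℕ) (h : Op dloc k) : Op dloc N :=
  ∑ l : Fin N, Tmat dloc N ^ (l : ℕ) * embed dloc k N h * (Tmat dloc N)ᴴ ^ (l : ℕ)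

/-- The operator norm (ℓ²→ℓ² norm) of a matrix. -/
noncomputable def opNorm {n : Type*} [Fintype n] [DecidableEq n] (A : Matrix n n ℂ) : ℝ :=
  ‖Matrix.toEuclideanCLM (𝕜 := ℂ) (n := n) A‖

/-- An orthonormal basis of simultaneous eigenvectors of the Hamiltonian `H` (with real
eigenvalues `E j`) and of the translation operator `T` (with eigenvalues `τ j`). -/
structure EigData (dloc N : ℕ) (H : Op dloc N) where
  v : (Fin N → Fin dloc) → ((Fin N → Fin dloc) → ℂ)
  E : (Fin N → Fin dloc) → ℝ
  τ : (Fin N → Fin dloc) → ℂ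
  orth : ∀ j j', star (v j) ⬝ᵥ v j' = if j = j' then 1 else 0
  eigH : ∀ j, H.mulVec (v j) = (E j : ℂ) • v j
  eigT : ∀ j, (Tmat dloc N).mulVec (v j) = τ j • v j

/-- The eigenstate expectation value `⟨j|B|j⟩`. -/
noncomputable def eev {dloc N : ℕ} {H : Op dloc N} (D : EigData dloc N H)
    (B : Op dloc N) (j : Fin N → Fin dloc) : ℂ :=
  star (D.v j) ⬝ᵥ B.mulVec (D.v j)

/-- `r_f(N) = ((1/d) ∑_j |⟨j|B|j⟩ - f(E_j/N)|²)^{1/2}`. -/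
noncomputable def rf {dloc N : ℕ} {H : Op dloc N} (D : EigData dloc N H)
    (B : Op dloc N) (f : ℝ → ℂ) : ℝ :=
  Real.sqrt ((1 / (dloc : ℝ) ^ N) * ∑ j, ‖eev D B j - f (D.E j / N)‖ ^ 2)

/-- A function `f : [-1,1] → {z : ℂ, |z| ≤ 1}` (encoded as a total function on `ℝ`)
is smooth with Taylor data `c0 = f(0)`, `c1 = f'(0)`, `c2 = f''(0)` and remainder
constant `M` if `|f(x) - c0 - c1 x - (c2/2) x²| ≤ M |x|³` on `[-1,1]`. -/
def SmoothFn (f : ℝ → ℂ) (c0 c1 c2 : ℂ) (M : ℝ) : Prop :=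
  0 ≤ M ∧ (∀ x ∈ Set.Icc (-1 : ℝ) 1, ‖f x‖ ≤ 1) ∧
    ∀ x ∈ Set.Icc (-1 : ℝ) 1, ‖f x - c0 - c1 * x - c2 / 2 * x ^ 2‖ ≤ M * |x| ^ 3

/-- The generalized Pauli string `X^{a_1}Z^{b_1} ⊗ ⋯ ⊗ X^{a_m}Z^{b_m}` on `m` qudits,
where `X|x⟩ = |x+1 mod dloc⟩` and `Z|x⟩ = ω^x |x⟩` with `ω = exp(2πi/dloc)`. -/
noncomputable def pauli (dloc m : ℕ) (a b : Fin m → Fin dloc) : Op dloc m :=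
  fun x y =>
    if ∀ i, (x i : ℕ) = ((y i : ℕ) + (a i : ℕ)) % dloc then
      ∏ i, Complex.exp (2 * Real.pi * Complex.I * (b i : ℕ) * (y i : ℕ) / dloc)
    else 0

/-- An operator on `k` sites is canonical if every generalized Pauli string with nonzero
coefficient in its expansion acts nontrivially on site 1. -/
def Canonical (dloc k : ℕ) (h : Op dloc k) : Prop :=
  ∀ a b : Fin k → Fin dloc,
    (∀ i : Fin k, (i : ℕ) = 0 → (a i : ℕ) = 0 ∧ (b i : ℕ) = 0) →
      Matrix.trace ((pauli dloc k a b)ᴴ * h) = 0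

/-- An operator on `k` sites is exactly `k`-local if some generalized Pauli string with
nonzero coefficient in its expansion acts nontrivially on site `k`. -/
def ExactlyLocal (dloc k : ℕ) (h : Op dloc k) : Prop :=
  ∃ a b : Fin k → Fin dloc, ∃ i : Fin k, (i : ℕ) = k - 1 ∧ ((a i : ℕ) ≠ 0 ∨ (b i : ℕ) ≠ 0) ∧
    Matrix.trace ((pauli dloc k a b)ᴴ * h) ≠ 0

/-- The submodule (over `ℝ`) of traceless operators on `k'` sites. -/
noncomputable def tracelessOps (dloc k' : ℕ) : Submodule ℝ (Op dloc k') :=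
  LinearMap.ker ((Matrix.traceLinearMap (Fin k' → Fin dloc) ℂ ℂ).restrictScalars ℝ)

/-- The translation average `𝔸 = (1/N) ∑_{l=0}^{N-1} T^l A T^{-l}` of an operator. -/
noncomputable def tavg (dloc N : ℕ) (A : Op dloc N) : Op dloc N :=
  ((N : ℂ))⁻¹ • ∑ l : Fin N, Tmat dloc N ^ (l : ℕ) * A * (Tmat dloc N)ᴴ ^ (l : ℕ)

set_option linter.unusedSectionVars false

section Place

open scoped Kronecker

variable {ι κ μ α : Type*} [Fintype ι] [DecidableEq ι] [Fintype κ] [DecidableEq κ]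
  [Fintype μ] [DecidableEq μ] [Fintype α] [DecidableEq α]

open Classical in
/-- The operator `a`, acting on the sites `φ j` of a lattice `ι` and as the identity elsewhere. -/
noncomputable def place (φ : κ → ι) (a : Matrix (κ → α) (κ → α) ℂ) :
    Matrix (ι → α) (ι → α) ℂ :=
  fun x y => a (x ∘ φ) (y ∘ φ) * if ∀ i ∉ Set.range φ, x i = y i then 1 else 0

/-- The normalized trace. -/
noncomputable def ntr : Matrix (ι → α) (ι → α) ℂ →ₗ[ℂ] ℂ :=
  ((Fintype.card α : ℂ) ^ Fintype.card ι)⁻¹ • Matrix.traceLinearMap (ι → α) ℂ ℂ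

theorem ntr_apply (X : Matrix (ι → α) (ι → α) ℂ) :
    ntr X = X.trace / (Fintype.card α : ℂ) ^ Fintype.card ι := by
  simp [ntr, div_eq_inv_mul]

theorem ntr_mul_comm (X Y : Matrix (ι → α) (ι → α) ℂ) : ntr (X * Y) = ntr (Y * X) := by
  rw [ntr_apply, ntr_apply, Matrix.trace_mul_comm]

/-- Splitting a configuration into its part on the range of `φ` and the rest. -/
noncomputable def splitEquiv (φ : κ → ι) (hφ : Function.Injective φ) :
    (ι → α) ≃ (κ → α) × ({i // i ∉ Set.range φ} → α) := by
  classical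
  refine Equiv.ofBijective (fun x => (x ∘ φ, fun i => x i)) ⟨?_, ?_⟩
  · intro x y hxy
    simp only [Prod.mk.injEq] at hxy
    funext i
    by_cases hi : i ∈ Set.range φ
    · obtain ⟨j, rfl⟩ := hi
      exact congrFun hxy.1 j
    · exact congrFun hxy.2 ⟨i, hi⟩
  · rintro ⟨u, v⟩
    refine ⟨fun i => if hi : i ∈ Set.range φ then u hi.choose else v ⟨i, hi⟩, ?_⟩
    refine Prod.ext ?_ ?_
    · funext j
      have hj : φ j ∈ Set.range φ := ⟨j, rfl⟩
      simp only [Function.comp_apply, dif_pos hj]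
      exact congrArg u (hφ hj.choose_spec)
    · funext i
      simp only [dif_neg i.2]

theorem splitEquiv_apply (φ : κ → ι) (hφ : Function.Injective φ) (x : ι → α) :
    splitEquiv φ hφ x = (x ∘ φ, fun i => x i.1) := rfl

theorem place_eq_kronecker (φ : κ → ι) (hφ : Function.Injective φ)
    (a : Matrix (κ → α) (κ → α) ℂ) :
    place φ a = (a ⊗ₖ (1 : Matrix ({i // i ∉ Set.range φ} → α) _ ℂ)).submatrix
      (splitEquiv φ hφ) (splitEquiv φ hφ) := by
  ext x y
  simp only [place, Matrix.submatrix_apply, splitEquiv_apply, Matrix.kroneckerMap_apply,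
    Matrix.one_apply]
  congr 1
  refine if_congr ?_ rfl rfl
  simp [funext_iff]

theorem place_val_eq_kronecker (φ : κ → ι) (hφ : Function.Injective φ)
    (g : Matrix ({i // i ∉ Set.range φ} → α) ({i // i ∉ Set.range φ} → α) ℂ) :
    place Subtype.val g = ((1 : Matrix (κ → α) (κ → α) ℂ) ⊗ₖ g).submatrix
      (splitEquiv φ hφ) (splitEquiv φ hφ) := by
  ext x y
  simp only [place, Matrix.submatrix_apply, splitEquiv_apply, Matrix.kroneckerMap_apply,
    Matrix.one_apply, Function.comp_def]
  rw [mul_comm]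
  congr 1
  refine if_congr ?_ rfl rfl
  simp [funext_iff]

/-- Placement on the range of an injection, as a star algebra homomorphism. -/
noncomputable def placeHom (φ : κ → ι) (hφ : Function.Injective φ) :
    Matrix (κ → α) (κ → α) ℂ →⋆ₐ[ℂ] Matrix (ι → α) (ι → α) ℂ where
  toFun := place φ
  map_one' := by simp [place_eq_kronecker φ hφ]
  map_mul' a b := by
    simp only [place_eq_kronecker φ hφ, Matrix.submatrix_mul_equiv, ← Matrix.mul_kronecker_mul,
      mul_one]
  map_zero' := by ext; simp [place]
  map_add' a b := by ext; simp only [place, Matrix.add_apply, add_mul]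
  commutes' c := by
    simp only [place_eq_kronecker φ hφ, Algebra.algebraMap_eq_smul_one, Matrix.smul_kronecker,
      Matrix.one_kronecker_one, Matrix.submatrix_smul, Pi.smul_apply, Matrix.submatrix_one_equiv]
  map_star' a := by
    simp only [place_eq_kronecker φ hφ, Matrix.star_eq_conjTranspose,
      Matrix.conjTranspose_submatrix, Matrix.conjTranspose_kronecker, Matrix.conjTranspose_one]

theorem placeHom_apply (φ : κ → ι) (hφ : Function.Injective φ) (a : Matrix (κ → α) (κ → α) ℂ) :
    placeHom φ hφ a = place φ a := rfl

theorem place_place (ψ : κ → ι) (hψ : Function.Injective ψ) (φ : μ → κ)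
    (a : Matrix (μ → α) (μ → α) ℂ) : place ψ (place φ a) = place (ψ ∘ φ) a := by
  ext x y
  simp only [place, Function.comp_assoc, ← ite_and, mul_ite, mul_one, mul_zero]
  refine if_congr ?_ rfl rfl
  constructor
  · rintro ⟨h1, h2⟩ i hi
    by_cases hi' : i ∈ Set.range ψ
    · obtain ⟨j, rfl⟩ := hi'
      refine h2 j ?_
      rintro ⟨l, rfl⟩
      exact hi ⟨l, rfl⟩
    · exact h1 i hi'
  · intro H
    refine ⟨fun i hi => H i ?_, fun j hj => H _ ?_⟩
    · rintro ⟨l, rfl⟩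
      exact hi ⟨_, rfl⟩
    · rintro ⟨l, hl⟩
      exact hj ⟨l, hψ hl⟩

theorem trace_submatrix_equiv_self {m n : Type*} [Fintype m] [Fintype n] (e : m ≃ n)
    (X : Matrix n n ℂ) : (X.submatrix e e).trace = X.trace := by
  simp only [Matrix.trace, Matrix.diag_apply, Matrix.submatrix_apply]
  exact e.sum_comp (fun i => X i i)

theorem ntr_mul_place_val [Nonempty α] (φ : κ → ι) (hφ : Function.Injective φ)
    (a : Matrix (κ → α) (κ → α) ℂ)
    (g : Matrix ({i // i ∉ Set.range φ} → α) ({i // i ∉ Set.range φ} → α) ℂ) :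
    ntr (place φ a * place Subtype.val g) = ntr a * ntr g := by
  classical
  have hc : (Fintype.card α : ℂ) ^ Fintype.card ι =
      (Fintype.card α : ℂ) ^ Fintype.card κ *
        (Fintype.card α : ℂ) ^ Fintype.card {i // i ∉ Set.range φ} := by
    have := Fintype.card_congr (splitEquiv (α := α) φ hφ)
    simp only [Fintype.card_fun, Fintype.card_prod] at this
    exact_mod_cast this
  rw [place_eq_kronecker φ hφ, place_val_eq_kronecker φ hφ, Matrix.submatrix_mul_equiv,
    ← Matrix.mul_kronecker_mul, mul_one, one_mul, ntr_apply, trace_submatrix_equiv_self,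
    Matrix.trace_kronecker, ntr_apply, ntr_apply, hc, div_mul_div_comm]

theorem ntr_one [Nonempty α] : ntr (1 : Matrix (ι → α) (ι → α) ℂ) = 1 := by
  rw [ntr_apply, Matrix.trace_one, Fintype.card_fun]
  push_cast
  exact div_self (pow_ne_zero _ (by simp))

theorem ntr_place [Nonempty α] (φ : κ → ι) (hφ : Function.Injective φ)
    (a : Matrix (κ → α) (κ → α) ℂ) : ntr (place φ a) = ntr a := by
  classical
  have h1 := ntr_mul_place_val φ hφ a 1
  rwa [← placeHom_apply Subtype.val Subtype.val_injective, map_one, mul_one, ntr_one,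
    mul_one] at h1

/-- The operator `X` acts trivially on the range of `φ`. -/
def AwayFrom (φ : κ → ι) (X : Matrix (ι → α) (ι → α) ℂ) : Prop :=
  ∃ g : Matrix ({i // i ∉ Set.range φ} → α) ({i // i ∉ Set.range φ} → α) ℂ,
    X = place Subtype.val g

theorem awayFrom_place (φ : κ → ι) (ψ : μ → ι) (h : ∀ i j, ψ i ≠ φ j)
    (a : Matrix (μ → α) (μ → α) ℂ) : AwayFrom φ (place ψ a) := by
  classical
  refine ⟨place (fun i => ⟨ψ i, fun ⟨j, hj⟩ => h i j hj.symm⟩) a, ?_⟩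
  rw [place_place _ Subtype.val_injective]
  rfl

theorem AwayFrom.mul {φ : κ → ι} {X Y : Matrix (ι → α) (ι → α) ℂ} (hX : AwayFrom φ X)
    (hY : AwayFrom φ Y) : AwayFrom φ (X * Y) := by
  classical
  obtain ⟨g, rfl⟩ := hX
  obtain ⟨g', rfl⟩ := hY
  exact ⟨g * g', (map_mul (placeHom _ Subtype.val_injective) g g').symm⟩

theorem AwayFrom.pow {φ : κ → ι} {X : Matrix (ι → α) (ι → α) ℂ} (hX : AwayFrom φ X) (n : ℕ) :
    AwayFrom φ (X ^ n) := by
  classical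
  obtain ⟨g, rfl⟩ := hX
  exact ⟨g ^ n, (map_pow (placeHom _ Subtype.val_injective) g n).symm⟩

theorem AwayFrom.sum {φ : κ → ι} {γ : Type*} (s : Finset γ) (X : γ → Matrix (ι → α) (ι → α) ℂ)
    (hX : ∀ c ∈ s, AwayFrom φ (X c)) : AwayFrom φ (∑ c ∈ s, X c) := by
  classical
  choose! g hg using hX
  refine ⟨∑ c ∈ s, g c, ?_⟩
  rw [← placeHom_apply Subtype.val Subtype.val_injective, map_sum]
  exact Finset.sum_congr rfl hg

theorem AwayFrom.ntr_place_mul_eq_zero [Nonempty α] {φ : κ → ι} (hφ : Function.Injective φ)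
    {X : Matrix (ι → α) (ι → α) ℂ} (hX : AwayFrom φ X) {a : Matrix (κ → α) (κ → α) ℂ}
    (ha : a.trace = 0) : ntr (place φ a * X) = 0 := by
  classical
  obtain ⟨g, rfl⟩ := hX
  rw [ntr_mul_place_val φ hφ, ntr_apply a, ha, zero_div, zero_mul]

theorem AwayFrom.commute {φ : κ → ι} (hφ : Function.Injective φ)
    {X : Matrix (ι → α) (ι → α) ℂ} (hX : AwayFrom φ X) (a : Matrix (κ → α) (κ → α) ℂ) :
    Commute (place φ a) X := by
  classical
  obtain ⟨g, rfl⟩ := hX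
  simp only [Commute, SemiconjBy, place_eq_kronecker φ hφ, place_val_eq_kronecker φ hφ,
    Matrix.submatrix_mul_equiv, ← Matrix.mul_kronecker_mul, mul_one, one_mul]

end Place

section Norms

open scoped Matrix.Norms.L2Operator

variable {ι κ α : Type*} [Fintype ι] [DecidableEq ι] [Fintype κ] [DecidableEq κ]
  [Fintype α] [DecidableEq α]

theorem opNorm_eq_norm {n : Type*} [Fintype n] [DecidableEq n] (X : Matrix n n ℂ) :
    opNorm X = ‖X‖ := rfl

theorem opNorm_place_le (φ : κ → ι) (hφ : Function.Injective φ)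
    (a : Matrix (κ → α) (κ → α) ℂ) : opNorm (place φ a) ≤ opNorm a := by
  rw [opNorm_eq_norm, opNorm_eq_norm, ← placeHom_apply φ hφ]
  exact NonUnitalStarAlgHom.norm_apply_le (placeHom φ hφ) a

end Norms

section Chain

/-- The `m` consecutive sites starting at site `l` of the periodic chain of length `N`. -/
def interval (m N : ℕ) [NeZero N] (l : ℕ) : Fin m → Fin N := fun i => Fin.ofNat N (l + i)

theorem val_interval (m N : ℕ) [NeZero N] (l : ℕ) (i : Fin m) :
    (interval m N l i : ℕ) = (l + i) % N := rfl

theorem interval_injective {m N : ℕ} [NeZero N] (hm : m ≤ N) (l : ℕ) :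
    Function.Injective (interval m N l) := by
  intro i j hij
  have h1 : (l + i : ℕ) ≡ l + j [MOD N] := congrArg Fin.val hij
  have h2 : (i : ℕ) ≡ j [MOD N] := Nat.ModEq.add_left_cancel' l h1
  exact Fin.ext (Nat.ModEq.eq_of_lt_of_lt h2 (i.2.trans_le hm) (j.2.trans_le hm))

theorem interval_comp {k m N : ℕ} [NeZero m] [NeZero N] (c b : ℕ) (hb : b + k ≤ m) :
    interval m N c ∘ interval k m b = interval k N (c + b) := by
  funext i
  apply Fin.ext
  have hi := i.2
  rw [Function.comp_apply, val_interval, val_interval, val_interval,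
    Nat.mod_eq_of_lt (show b + (i : ℕ) < m by omega), add_assoc]

theorem interval_self_comp {k N : ℕ} [NeZero N] (c b : ℕ) :
    interval N N c ∘ interval k N b = interval k N (c + b) := by
  funext i
  apply Fin.ext
  rw [Function.comp_apply, val_interval, val_interval, val_interval, Nat.add_mod_mod, add_assoc]

theorem interval_add_self (m N : ℕ) [NeZero N] (l : ℕ) :
    interval m N (l + N) = interval m N l := by
  funext i
  apply Fin.ext
  rw [val_interval, val_interval, add_right_comm, Nat.add_mod_right]

theorem finRotate_eq_interval (N : ℕ) [NeZero N] : ⇑(finRotate N) = interval N N 1 := by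
  funext i
  apply Fin.ext
  rw [finRotate_apply, val_interval, Fin.val_add, Fin.val_one', Nat.add_mod_mod, add_comm]

variable {dloc : ℕ}

theorem Tmat_conj (N : ℕ) [NeZero N] (X : Op dloc N) :
    Tmat dloc N * X * (Tmat dloc N)ᴴ = place (interval N N 1) X := by
  have hs : ∀ x y : Fin N → Fin dloc,
      (x = confShift dloc N y) ↔ (x ∘ interval N N 1 = y) := by
    intro x y
    rw [← finRotate_eq_interval]
    constructor
    · rintro rfl
      funext i
      simp [confShift]
    · rintro rfl
      funext i
      simp [confShift]
  have hr : ∀ i, i ∈ Set.range (interval N N 1) := by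
    rw [← finRotate_eq_interval]
    exact (finRotate N).surjective
  ext x y
  simp [Matrix.mul_apply, Tmat, hs, place, hr, -Set.mem_range]

theorem Tmat_pow_conj (N : ℕ) [NeZero N] (X : Op dloc N) (l : ℕ) :
    Tmat dloc N ^ l * X * (Tmat dloc N)ᴴ ^ l = place (interval N N l) X := by
  induction l with
  | zero =>
    have : interval N N 0 = id := by
      funext i
      apply Fin.ext
      rw [val_interval, zero_add, Nat.mod_eq_of_lt i.2, id]
    rw [this]
    ext x y
    simp [place]
  | succ l ih =>
    rw [pow_succ', pow_succ, show ∀ a b c d e : Op dloc N, a * b * c * (d * e) = a * (b * c * d) * e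
      by intros; simp only [mul_assoc], ih, Tmat_conj,
      place_place _ (interval_injective le_rfl _), interval_self_comp, add_comm]

theorem embed_eq_place {m N : ℕ} [NeZero N] (hm : m ≤ N) (a : Op dloc m) :
    embed dloc m N a = place (interval m N 0) a := by
  have hc : interval m N 0 = Fin.castLE hm := by
    funext i
    apply Fin.ext
    rw [val_interval, zero_add, Nat.mod_eq_of_lt (i.2.trans_le hm), Fin.val_castLE]
  rw [hc]
  refine (dif_pos hm).trans ?_
  funext x y
  have hiff : (∀ i : Fin N, m ≤ (i : ℕ) → x i = y i) ↔
      ∀ i ∉ Set.range (Fin.castLE hm), x i = y i := by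
    simp [Fin.range_castLE]
  refine congrArg _ ?_
  by_cases H : ∀ i : Fin N, m ≤ (i : ℕ) → x i = y i
  · exact (if_pos H).trans (if_pos (hiff.1 H)).symm
  · exact (if_neg H).trans (if_neg (mt hiff.2 H)).symm

theorem Ham_eq_sum {k N : ℕ} [NeZero N] (hk : k ≤ N) (h : Op dloc k) :
    Ham dloc k N h = ∑ l ∈ Finset.range N, place (interval k N l) h := by
  rw [Ham, Finset.sum_range]
  refine Finset.sum_congr rfl fun l _ => ?_
  rw [Tmat_pow_conj, embed_eq_place hk, place_place _ (interval_injective le_rfl _),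
    interval_self_comp, add_zero]

theorem Ham_eq_sum_shift {k N : ℕ} [NeZero N] (hk : k ≤ N) (h : Op dloc k) (c : ℕ) :
    Ham dloc k N h = ∑ l ∈ Finset.range N, place (interval k N (c + l)) h := by
  induction c with
  | zero => simp only [zero_add, Ham_eq_sum hk]
  | succ c ih =>
    rw [ih]
    have e := (Finset.sum_range_succ (fun l => place (interval k N (c + l)) h) N).symm.trans
      (Finset.sum_range_succ' _ N)
    rw [interval_add_self, add_zero] at e
    simpa only [add_assoc, add_comm, add_left_comm] using add_right_cancel e

theorem place_interval_Ham {k N : ℕ} [NeZero N] (hk : k ≤ N) (h : Op dloc k) (c : ℕ) :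
    place (interval N N c) (Ham dloc k N h) = Ham dloc k N h := by
  conv_rhs => rw [Ham_eq_sum_shift hk h c]
  rw [Ham_eq_sum hk, ← placeHom_apply _ (interval_injective le_rfl _), map_sum]
  refine Finset.sum_congr rfl fun l _ => ?_
  rw [placeHom_apply, place_place _ (interval_injective le_rfl _), interval_self_comp]

theorem ntr_Ham_pow_succ {k N : ℕ} [NeZero dloc] [NeZero N] (hk : k ≤ N) (h : Op dloc k) (n : ℕ) :
    ntr (Ham dloc k N h ^ (n + 1)) = N * ntr (Ham dloc k N h ^ n * embed dloc k N h) := by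
  have key : ∀ l ∈ Finset.range N, ntr (Ham dloc k N h ^ n * place (interval k N l) h) =
      ntr (Ham dloc k N h ^ n * embed dloc k N h) := by
    intro l _
    have e : place (interval N N l) (Ham dloc k N h ^ n * embed dloc k N h) =
        Ham dloc k N h ^ n * place (interval k N l) h := by
      rw [← placeHom_apply _ (interval_injective le_rfl _), map_mul, map_pow, placeHom_apply,
        placeHom_apply, place_interval_Ham hk, embed_eq_place hk,
        place_place _ (interval_injective le_rfl _), interval_self_comp, add_zero]
    rw [← e, ntr_place _ (interval_injective le_rfl _)]
  conv_lhs => rw [pow_succ]; arg 2; arg 2; rw [Ham_eq_sum hk]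
  rw [Finset.mul_sum, map_sum, Finset.sum_congr rfl key, Finset.sum_const, Finset.card_range,
    nsmul_eq_mul]

/-- The part of the Hamiltonian near the first `k'` sites, on an open window of fixed length. -/
noncomputable def windowHam (k k' : ℕ) (h : Op dloc k) : Op dloc (4 * k + k' + 1) :=
  ∑ j ∈ Finset.range (3 * k + k'), place (interval k (4 * k + k' + 1) j) h

/-- The part of the Hamiltonian far from the first `k'` sites. -/
noncomputable def farHam (k k' N : ℕ) [NeZero N] (h : Op dloc k) : Op dloc N :=
  ∑ j ∈ Finset.Ico (3 * k + k') N, place (interval k N (N - 2 * k + j)) h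

theorem Ham_eq_window_add_far {k k' N : ℕ} [NeZero N] (hN : 4 * k + k' + 1 ≤ N) (h : Op dloc k) :
    Ham dloc k N h =
      place (interval (4 * k + k' + 1) N (N - 2 * k)) (windowHam k k' h) + farHam k k' N h := by
  rw [Ham_eq_sum_shift (by omega) h (N - 2 * k), farHam, windowHam,
    ← placeHom_apply _ (interval_injective hN _), map_sum,
    ← Finset.sum_range_add_sum_Ico _ (show 3 * k + k' ≤ N by omega)]
  congr 1
  refine Finset.sum_congr rfl fun j hj => ?_
  rw [Finset.mem_range] at hj
  rw [placeHom_apply, place_place _ (interval_injective hN _), interval_comp _ _ (by omega)]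

theorem embed_eq_place_window {k k' N : ℕ} [NeZero N] (hN : 4 * k + k' + 1 ≤ N) (A : Op dloc k') :
    embed dloc k' N A = place (interval (4 * k + k' + 1) N (N - 2 * k))
      (place (interval k' (4 * k + k' + 1) (2 * k)) A) := by
  rw [place_place _ (interval_injective hN _), interval_comp _ _ (by omega),
    show N - 2 * k + 2 * k = 0 + N by omega, interval_add_self, embed_eq_place (by omega)]

theorem Nat.mod_eq_or_of_lt_two_mul {x N : ℕ} (hx : x < 2 * N) :
    x % N = x ∧ x < N ∨ x % N = x - N ∧ N ≤ x := by
  rcases lt_or_ge x N with h | h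
  · exact Or.inl ⟨Nat.mod_eq_of_lt h, h⟩
  · refine Or.inr ⟨?_, h⟩
    rw [Nat.mod_eq_sub_mod h, Nat.mod_eq_of_lt (by omega)]

theorem interval_far_ne {k k' N : ℕ} [NeZero N] (hN : 4 * k + k' + 1 ≤ N) {j : ℕ}
    (hj : 3 * k + k' ≤ j) (hjN : j < N) (i : Fin k) (a : Fin k') :
    interval k N (N - 2 * k + j) i ≠ interval k' N 0 a := by
  intro h
  have h' := congrArg Fin.val h
  rw [val_interval, val_interval] at h'
  have hi := i.2
  have ha := a.2
  rcases Nat.mod_eq_or_of_lt_two_mul (show N - 2 * k + j + i < 2 * N by omega) with h1 | h1 <;>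
  rcases Nat.mod_eq_or_of_lt_two_mul (show 0 + (a : ℕ) < 2 * N by omega) with h2 | h2 <;> omega

theorem interval_far_ne_of_near {k k' N : ℕ} [NeZero N] (hN : 4 * k + k' + 1 ≤ N) {j j' : ℕ}
    (hj : 3 * k + k' ≤ j) (hjN : j < N) (hj' : j' < N) {i₀ : Fin k} {a : Fin k'}
    (h0 : interval k N (N - 2 * k + j') i₀ = interval k' N 0 a) (i' i : Fin k) :
    interval k N (N - 2 * k + j') i' ≠ interval k N (N - 2 * k + j) i := by
  intro h
  have h' := congrArg Fin.val h
  have h0' := congrArg Fin.val h0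
  rw [val_interval, val_interval] at h' h0'
  have hi := i.2
  have hi' := i'.2
  have hi₀ := i₀.2
  have ha := a.2
  rcases Nat.mod_eq_or_of_lt_two_mul (show N - 2 * k + j + i < 2 * N by omega) with h1 | h1 <;>
  rcases Nat.mod_eq_or_of_lt_two_mul (show N - 2 * k + j' + i' < 2 * N by omega) with h2 | h2 <;>
  rcases Nat.mod_eq_or_of_lt_two_mul (show N - 2 * k + j' + i₀ < 2 * N by omega) with h3 | h3 <;>
  rcases Nat.mod_eq_or_of_lt_two_mul (show 0 + (a : ℕ) < 2 * N by omega) with h4 | h4 <;> omega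

theorem awayFrom_farHam {k k' N : ℕ} [NeZero N] (hN : 4 * k + k' + 1 ≤ N) (h : Op dloc k) :
    AwayFrom (interval k' N 0) (farHam k k' N h) := by
  refine AwayFrom.sum _ _ fun j hj => awayFrom_place _ _ (fun i a => ?_) h
  rw [Finset.mem_Ico] at hj
  exact interval_far_ne hN hj.1 hj.2 i a

variable [NeZero dloc]

theorem ntr_far_mul_eq_zero {k k' N : ℕ} [NeZero N] (hN : 4 * k + k' + 1 ≤ N) (h : Op dloc k)
    (htr : h.trace = 0) (A : Op dloc k') (hA : A.trace = 0) {j j' : ℕ}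
    (hj : 3 * k + k' ≤ j) (hjN : j < N) (hj' : j' < N) :
    ntr (place (interval k N (N - 2 * k + j)) h * place (interval k N (N - 2 * k + j')) h *
        place (interval k' N 0) A) = 0 ∧
      ntr (place (interval k N (N - 2 * k + j')) h * place (interval k N (N - 2 * k + j)) h *
        place (interval k' N 0) A) = 0 := by
  have hfar := awayFrom_place (interval k' N 0) (interval k N (N - 2 * k + j))
    (fun i a => interval_far_ne hN hj hjN i a) h
  by_cases hd : ∀ i a, interval k N (N - 2 * k + j') i ≠ interval k' N 0 a
  · have hd' := awayFrom_place (interval k' N 0) (interval k N (N - 2 * k + j')) hd h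
    constructor <;> rw [ntr_mul_comm]
    · exact (hfar.mul hd').ntr_place_mul_eq_zero (interval_injective (by omega) _) hA
    · exact (hd'.mul hfar).ntr_place_mul_eq_zero (interval_injective (by omega) _) hA
  · push Not at hd
    obtain ⟨i₀, a, h0⟩ := hd
    have h1 := awayFrom_place (interval k N (N - 2 * k + j)) (interval k N (N - 2 * k + j'))
      (interval_far_ne_of_near hN hj hjN hj' h0) h
    have h2 := awayFrom_place (interval k N (N - 2 * k + j)) (interval k' N 0)
      (fun a i => (interval_far_ne hN hj hjN i a).symm) A
    constructor
    · rw [mul_assoc]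
      exact (h1.mul h2).ntr_place_mul_eq_zero (interval_injective (by omega) _) htr
    · rw [mul_assoc, ntr_mul_comm, mul_assoc]
      exact (h2.mul h1).ntr_place_mul_eq_zero (interval_injective (by omega) _) htr

theorem ntr_Ham_mul_embed {k k' N : ℕ} [NeZero N] (hN : 4 * k + k' + 1 ≤ N) (h : Op dloc k)
    (A : Op dloc k') (hA : A.trace = 0) :
    ntr (Ham dloc k N h * embed dloc k' N A) =
      ntr (windowHam k k' h * place (interval k' (4 * k + k' + 1) (2 * k)) A) := by
  have hF : ntr (farHam k k' N h * embed dloc k' N A) = 0 := by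
    rw [ntr_mul_comm, embed_eq_place (by omega)]
    exact (awayFrom_farHam hN h).ntr_place_mul_eq_zero (interval_injective (by omega) _) hA
  rw [Ham_eq_window_add_far hN, add_mul, map_add, hF, add_zero, embed_eq_place_window hN,
    ← placeHom_apply _ (interval_injective hN _), ← placeHom_apply _ (interval_injective hN _),
    ← map_mul, placeHom_apply, ntr_place _ (interval_injective hN _)]

theorem ntr_Ham_sq_mul_embed {k k' N : ℕ} [NeZero N] (hN : 4 * k + k' + 1 ≤ N) (h : Op dloc k)
    (htr : h.trace = 0) (A : Op dloc k') (hA : A.trace = 0) :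
    ntr (Ham dloc k N h ^ 2 * embed dloc k' N A) =
      ntr (windowHam k k' h ^ 2 * place (interval k' (4 * k + k' + 1) (2 * k)) A) := by
  have hsum := Ham_eq_sum_shift (show k ≤ N by omega) h (N - 2 * k)
  have h1 : ntr (farHam k k' N h * Ham dloc k N h * embed dloc k' N A) = 0 := by
    rw [hsum, farHam, embed_eq_place (by omega), Finset.sum_mul_sum, Finset.sum_mul, map_sum]
    refine Finset.sum_eq_zero fun j hj => ?_
    rw [Finset.sum_mul, map_sum]
    refine Finset.sum_eq_zero fun j' hj' => ?_
    rw [Finset.mem_Ico] at hj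
    exact (ntr_far_mul_eq_zero hN h htr A hA hj.1 hj.2 (Finset.mem_range.1 hj')).1
  have h2 : ∀ s : Finset ℕ, (∀ j' ∈ s, j' < N) →
      ntr ((∑ j' ∈ s, place (interval k N (N - 2 * k + j')) h) * farHam k k' N h *
        embed dloc k' N A) = 0 := by
    intro s hs
    rw [farHam, embed_eq_place (by omega), Finset.sum_mul_sum, Finset.sum_mul, map_sum]
    refine Finset.sum_eq_zero fun j' hj' => ?_
    rw [Finset.sum_mul, map_sum]
    refine Finset.sum_eq_zero fun j hj => ?_
    rw [Finset.mem_Ico] at hj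
    exact (ntr_far_mul_eq_zero hN h htr A hA hj.1 hj.2 (hs j' hj')).2
  have h3 := h2 (Finset.range N) (fun j hj => Finset.mem_range.1 hj)
  have h4 := h2 (Finset.Ico (3 * k + k') N) (fun j hj => (Finset.mem_Ico.1 hj).2)
  rw [← hsum] at h3
  change ntr (farHam k k' N h * farHam k k' N h * embed dloc k' N A) = 0 at h4
  have hW : place (interval (4 * k + k' + 1) N (N - 2 * k)) (windowHam k k' h) =
      Ham dloc k N h - farHam k k' N h := by
    rw [Ham_eq_window_add_far hN, add_sub_cancel_right]
  have h5 : ntr (windowHam k k' h ^ 2 * place (interval k' (4 * k + k' + 1) (2 * k)) A) =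
      ntr ((Ham dloc k N h - farHam k k' N h) ^ 2 * embed dloc k' N A) := by
    rw [← hW, embed_eq_place_window hN, ← placeHom_apply _ (interval_injective hN _),
      ← placeHom_apply _ (interval_injective hN _), ← map_pow, ← map_mul, placeHom_apply,
      ntr_place _ (interval_injective hN _)]
  rw [h5]
  simp only [pow_two, mul_sub, sub_mul, map_sub, h1, h3, h4, sub_zero]

end Chain

section HilbertSchmidt

variable {n : Type*} [Fintype n] [DecidableEq n]

/-- The Hilbert–Schmidt norm, normalized so that the identity has norm one. -/
noncomputable def hsNorm (X : Matrix n n ℂ) : ℝ :=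
  √((∑ i, ∑ j, ‖X i j‖ ^ 2) / Fintype.card n)

theorem hsNorm_nonneg (X : Matrix n n ℂ) : 0 ≤ hsNorm X := Real.sqrt_nonneg _

theorem hsNorm_sq (X : Matrix n n ℂ) :
    hsNorm X ^ 2 = (∑ i, ∑ j, ‖X i j‖ ^ 2) / Fintype.card n :=
  Real.sq_sqrt (by positivity)

section
attribute [local instance] Matrix.frobeniusNormedAddCommGroup

theorem hsNorm_eq_frobenius (X : Matrix n n ℂ) : hsNorm X = ‖X‖ / √(Fintype.card n) := by
  rw [hsNorm, Real.sqrt_div (by positivity), Matrix.frobenius_norm_def, Real.sqrt_eq_rpow]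
  simp only [Real.rpow_ofNat]

theorem hsNorm_sub_le (X Y : Matrix n n ℂ) : hsNorm (X - Y) ≤ hsNorm X + hsNorm Y := by
  simp only [hsNorm_eq_frobenius, ← add_div]
  gcongr
  exact norm_sub_le X Y

end

theorem hsNorm_conjTranspose (X : Matrix n n ℂ) : hsNorm Xᴴ = hsNorm X := by
  simp only [hsNorm, Matrix.conjTranspose_apply, norm_star]
  rw [Finset.sum_comm]

section
open scoped Matrix.Norms.L2Operator

theorem hsNorm_mul_le_left (B X : Matrix n n ℂ) : hsNorm (B * X) ≤ opNorm B * hsNorm X := by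
  have hB : 0 ≤ opNorm B := norm_nonneg _
  refine le_of_sq_le_sq ?_ (mul_nonneg hB (hsNorm_nonneg X))
  rw [mul_pow, hsNorm_sq, hsNorm_sq, mul_div_assoc']
  gcongr
  rw [Finset.sum_comm, Finset.sum_comm (f := fun i j => ‖X i j‖ ^ 2), Finset.mul_sum]
  refine Finset.sum_le_sum fun j _ => ?_
  have h1 := Matrix.l2_opNorm_mulVec B (WithLp.toLp 2 (fun i => X i j))
  have h2 := pow_le_pow_left₀ (norm_nonneg _) h1 2
  rw [mul_pow, EuclideanSpace.norm_sq_eq, EuclideanSpace.norm_sq_eq] at h2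
  exact h2

theorem hsNorm_mul_le_right (X B : Matrix n n ℂ) : hsNorm (X * B) ≤ hsNorm X * opNorm B := by
  have h1 := hsNorm_mul_le_left Bᴴ Xᴴ
  rw [← Matrix.conjTranspose_mul, hsNorm_conjTranspose, hsNorm_conjTranspose, opNorm_eq_norm,
    Matrix.l2_opNorm_conjTranspose] at h1
  rwa [mul_comm, opNorm_eq_norm]

end

theorem hsNorm_one_le : hsNorm (1 : Matrix n n ℂ) ≤ 1 := by
  rw [hsNorm, Real.sqrt_le_one]
  have : ∀ i j : n, ‖(1 : Matrix n n ℂ) i j‖ ^ 2 = if i = j then 1 else 0 := by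
    intro i j
    rw [Matrix.one_apply]
    split_ifs <;> simp
  simp only [this, Finset.sum_ite_eq, Finset.mem_univ, if_true, Finset.sum_const,
    Finset.card_univ, nsmul_eq_mul, mul_one]
  exact div_self_le_one _

theorem hsNorm_le_opNorm (B : Matrix n n ℂ) : hsNorm B ≤ opNorm B := by
  have h1 := hsNorm_mul_le_left B 1
  rw [mul_one] at h1
  exact h1.trans (mul_le_of_le_one_right (norm_nonneg _) hsNorm_one_le)

variable {ι α : Type*} [Fintype ι] [DecidableEq ι] [Fintype α] [DecidableEq α]

theorem norm_ntr_mul_le (X Y : Matrix (ι → α) (ι → α) ℂ) :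
    ‖ntr (X * Y)‖ ≤ hsNorm X * hsNorm Y := by
  have hc : ‖(Fintype.card α : ℂ) ^ Fintype.card ι‖ = Fintype.card (ι → α) := by
    rw [norm_pow, Complex.norm_natCast, Fintype.card_fun]
    push_cast
    rfl
  rw [ntr_apply, norm_div, hc, ← hsNorm_conjTranspose Y, hsNorm, hsNorm, ← Real.sqrt_mul
    (by positivity), div_mul_div_comm, Real.sqrt_div (by positivity), Real.sqrt_mul_self
    (by positivity)]
  gcongr
  rw [Real.sqrt_mul (by positivity)]
  simp only [← Finset.sum_product']
  refine le_trans ?_ (Real.sum_mul_le_sqrt_mul_sqrt _ _ _)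
  rw [Finset.sum_product]
  simp only [Matrix.trace, Matrix.diag_apply, Matrix.mul_apply, Matrix.conjTranspose_apply,
    norm_star]
  refine (norm_sum_le _ _).trans (Finset.sum_le_sum fun i _ => (norm_sum_le _ _).trans ?_)
  exact Finset.sum_le_sum fun j _ => (norm_mul_le _ _)

theorem ntr_conjTranspose_mul_self (X : Matrix (ι → α) (ι → α) ℂ) :
    ntr (Xᴴ * X) = (hsNorm X ^ 2 : ℝ) := by
  rw [ntr_apply, hsNorm_sq, Matrix.trace, Finset.sum_comm]
  push_cast [Fintype.card_fun]
  congr 1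
  simp only [Matrix.diag_apply, Matrix.mul_apply, Matrix.conjTranspose_apply]
  refine Finset.sum_congr rfl fun i _ => Finset.sum_congr rfl fun j _ => ?_
  exact Complex.conj_mul' _

/-- Moment bounds for a sum of `N` local terms: if `H` splits into a bounded part `B` and a part
`F` decoupled from the local term `u`, then the first three even moments grow like those of a
sum of independent variables. -/
theorem hsNorm_pow_bounds {H B F u : Matrix (ι → α) (ι → α) ℂ} {N b : ℝ} (hN : 1 ≤ N) (hb : 1 ≤ b)
    (hH : H.IsHermitian) (hsplit : H = B + F) (hB : opNorm B ≤ b) (hu : opNorm u ≤ 1)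
    (hcomm : Commute u F) (hF : ∀ n : ℕ, ntr (u * F ^ n) = 0)
    (hrec : ∀ n : ℕ, ntr (H ^ (n + 1)) = N * ntr (H ^ n * u)) :
    hsNorm H ^ 2 ≤ b * N ∧ hsNorm (H ^ 2) ^ 2 ≤ 12 * b ^ 3 * N ^ 2 ∧
      hsNorm (H ^ 3) ^ 2 ≤ 255 * b ^ 5 * N ^ 3 := by
  have hb0 : 0 ≤ b := zero_le_one.trans hb
  have hN0 : 0 ≤ N := zero_le_one.trans hN
  have q1 := hsNorm_nonneg H
  have q2 := hsNorm_nonneg (H ^ 2)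
  have mulB : ∀ X : Matrix (ι → α) (ι → α) ℂ, hsNorm (X * B) ≤ hsNorm X * b := fun X =>
    (hsNorm_mul_le_right X B).trans (mul_le_mul_of_nonneg_left hB (hsNorm_nonneg X))
  have Bmul : ∀ X : Matrix (ι → α) (ι → α) ℂ, hsNorm (B * X) ≤ b * hsNorm X := fun X =>
    (hsNorm_mul_le_left B X).trans (mul_le_mul_of_nonneg_right hB (hsNorm_nonneg X))
  have mulu : ∀ X : Matrix (ι → α) (ι → α) ℂ, hsNorm (X * u) ≤ hsNorm X := fun X =>
    (hsNorm_mul_le_right X u).trans (mul_le_of_le_one_right (hsNorm_nonneg X) hu)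
  have umul : ∀ X : Matrix (ι → α) (ι → α) ℂ, hsNorm (u * X) ≤ hsNorm X := fun X =>
    (hsNorm_mul_le_left u X).trans (mul_le_of_le_one_left (hsNorm_nonneg X) hu)
  have two : ∀ (X Y : Matrix (ι → α) (ι → α) ℂ) (s t : ℝ), hsNorm X ≤ s → hsNorm Y ≤ t →
      ‖ntr (X * Y)‖ ≤ s * t := fun X Y s t hX hY => (norm_ntr_mul_le X Y).trans
    (mul_le_mul hX hY (hsNorm_nonneg Y) ((hsNorm_nonneg X).trans hX))
  have hBF : B = H - F := by rw [hsplit, add_sub_cancel_right]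
  have hFB : F = H - B := by rw [hsplit, add_sub_cancel_left]
  have hF' : ∀ n : ℕ, ntr (F ^ n * u) = 0 := fun n => by rw [ntr_mul_comm, hF]
  have momentEq : ∀ m : ℕ, hsNorm (H ^ (m + 1)) ^ 2 ≤ N * ‖ntr (H ^ (2 * m + 1) * u)‖ := by
    intro m
    have e1 : ((hsNorm (H ^ (m + 1)) ^ 2 : ℝ) : ℂ) = N * ntr (H ^ (2 * m + 1) * u) := by
      rw [← ntr_conjTranspose_mul_self, (hH.pow (m + 1)).eq, ← pow_add, ← hrec]
      congr 2
      ring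
    have e2 := congrArg norm e1
    rw [Complex.norm_real, norm_mul, Complex.norm_real, Real.norm_of_nonneg hN0,
      Real.norm_of_nonneg (by positivity)] at e2
    exact e2.le
  have f1 : hsNorm F ≤ hsNorm H + b := by
    rw [hFB]
    exact (hsNorm_sub_le _ _).trans (add_le_add le_rfl ((hsNorm_le_opNorm B).trans hB))
  have fh : hsNorm (F * H) ≤ hsNorm (H ^ 2) + b * hsNorm H := by
    rw [hFB, sub_mul, ← pow_two]
    exact (hsNorm_sub_le _ _).trans (add_le_add le_rfl (Bmul H))
  have f2 : hsNorm (F ^ 2) ≤ hsNorm (H ^ 2) + b * hsNorm H + (hsNorm H + b) * b := by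
    have : F ^ 2 = F * H - F * B := by rw [← mul_sub, ← hFB, pow_two]
    rw [this]
    exact (hsNorm_sub_le _ _).trans (add_le_add fh ((mulB F).trans
      (mul_le_mul_of_nonneg_right f1 hb0)))
  have B1 : hsNorm H ^ 2 ≤ b * N := by
    have h1 : ‖ntr (H ^ 1 * u)‖ ≤ b := by
      have e : H ^ 1 * u = B * u + F ^ 1 * u := by
        rw [hsplit, pow_one, pow_one, add_mul]
      rw [e, map_add, hF', add_zero]
      have := two B u b 1 ((hsNorm_le_opNorm B).trans hB) ((hsNorm_le_opNorm u).trans hu)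
      rwa [mul_one] at this
    have h2 : hsNorm (H ^ 1) ^ 2 ≤ N * ‖ntr (H ^ 1 * u)‖ := momentEq 0
    rw [pow_one] at h1 h2
    linarith [mul_le_mul_of_nonneg_left h1 hN0]
  have B2 : hsNorm (H ^ 2) ^ 2 ≤ 12 * b ^ 3 * N ^ 2 := by
    have h1 : ‖ntr (H ^ 3 * u)‖ ≤ 3 * b * (hsNorm H + b) ^ 2 := by
      have e : H ^ 3 * u =
          H * (H * B * u) + (H * B) * (F * u) + (B * F) * (F * u) + F ^ 3 * u := by
        rw [hBF]; noncomm_ring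
      have t1 := two H (H * B * u) _ _ le_rfl ((mulu _).trans (mulB _))
      have t2 := two (H * B) (F * u) _ _ (mulB _) ((mulu _).trans f1)
      have t3 := two (B * F) (F * u) _ _ ((Bmul _).trans (mul_le_mul_of_nonneg_left f1 hb0))
        ((mulu _).trans f1)
      rw [e, map_add, map_add, map_add, hF', add_zero]
      refine (norm_add₃_le).trans ?_
      nlinarith [mul_nonneg hb0 q1, mul_nonneg (mul_nonneg hb0 q1) hb0,
        mul_nonneg (mul_nonneg hb0 hb0) hb0]
    have h2 : hsNorm (H ^ 2) ^ 2 ≤ N * ‖ntr (H ^ 3 * u)‖ := momentEq 1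
    have h3 : (hsNorm H + b) ^ 2 ≤ 4 * b ^ 2 * N := by
      have : (hsNorm H + b) ^ 2 ≤ 2 * hsNorm H ^ 2 + 2 * b ^ 2 := by
        nlinarith [sq_nonneg (hsNorm H - b)]
      have hbb : b * N ≤ b ^ 2 * N := by
        rw [pow_two, mul_assoc]
        exact le_mul_of_one_le_left (mul_nonneg hb0 hN0) hb
      have hbN : b ^ 2 ≤ b ^ 2 * N := le_mul_of_one_le_right (by positivity) hN
      linarith
    calc hsNorm (H ^ 2) ^ 2 ≤ N * (3 * b * (4 * b ^ 2 * N)) := by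
          refine h2.trans (mul_le_mul_of_nonneg_left (h1.trans ?_) hN0)
          exact mul_le_mul_of_nonneg_left h3 (by positivity)
      _ = 12 * b ^ 3 * N ^ 2 := by ring
  refine ⟨B1, B2, ?_⟩
  set g : ℝ := hsNorm (H ^ 2) + b * hsNorm H + (hsNorm H + b) * b with hg
  have g1 : hsNorm (H ^ 2) ≤ g := by
    have := mul_nonneg hb0 q1
    have := mul_nonneg (add_nonneg q1 hb0) hb0
    linarith
  have g2 : hsNorm (F * H) ≤ g := fh.trans (by
    have := mul_nonneg (add_nonneg q1 hb0) hb0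
    linarith)
  have h1 : ‖ntr (H ^ 5 * u)‖ ≤ 5 * b * g ^ 2 := by
    have e : H ^ 5 * u = H ^ 2 * (H ^ 2 * B * u) + H * ((H ^ 2 * B) * (F * u)) +
        (H ^ 2 * B) * (F ^ 2 * u) + (H * (B * F ^ 2)) * (F * u) + (B * F ^ 2) * (F ^ 2 * u) +
        F ^ 5 * u := by
      rw [hBF]; noncomm_ring
    have t1 := two (H ^ 2) (H ^ 2 * B * u) g (g * b) g1
      ((mulu _).trans ((mulB _).trans (mul_le_mul_of_nonneg_right g1 hb0)))
    have t2 : ‖ntr (H * ((H ^ 2 * B) * (F * u)))‖ ≤ g * b * g := by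
      have e2 : ntr (H * ((H ^ 2 * B) * (F * u))) = ntr ((H ^ 2 * B) * (u * (F * H))) := by
        simp only [ntr_mul_comm H, mul_assoc, hcomm.left_comm]
      rw [e2]
      exact two _ _ _ _ ((mulB _).trans (mul_le_mul_of_nonneg_right g1 hb0)) ((umul _).trans g2)
    have t3 := two (H ^ 2 * B) (F ^ 2 * u) (g * b) g
      ((mulB _).trans (mul_le_mul_of_nonneg_right g1 hb0)) ((mulu _).trans f2)
    have t4 : ‖ntr ((H * (B * F ^ 2)) * (F * u))‖ ≤ (b * g) * g := by
      have e4 : ntr ((H * (B * F ^ 2)) * (F * u)) = ntr ((B * F ^ 2) * (u * (F * H))) := by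
        simp only [ntr_mul_comm H, mul_assoc, hcomm.left_comm]
      rw [e4]
      exact two _ _ _ _ ((Bmul _).trans (mul_le_mul_of_nonneg_left f2 hb0)) ((umul _).trans g2)
    have t5 := two (B * F ^ 2) (F ^ 2 * u) (b * g) g
      ((Bmul _).trans (mul_le_mul_of_nonneg_left f2 hb0)) ((mulu _).trans f2)
    rw [e, map_add, hF', add_zero, map_add, map_add, map_add, map_add]
    refine (norm_add_le _ _).trans ?_
    refine (add_le_add (norm_add₄_le) le_rfl).trans ?_
    linarith
  have h2 : hsNorm (H ^ 3) ^ 2 ≤ N * ‖ntr (H ^ 5 * u)‖ := momentEq 2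
  have h3 : g ^ 2 ≤ 51 * b ^ 4 * N ^ 2 := by
    have e : g = hsNorm (H ^ 2) + 2 * (b * hsNorm H) + b ^ 2 := by rw [hg]; ring
    have h4 : g ^ 2 ≤ 3 * (hsNorm (H ^ 2) ^ 2 + 4 * (b ^ 2 * hsNorm H ^ 2) + b ^ 4) := by
      rw [e]
      nlinarith [sq_nonneg (hsNorm (H ^ 2) - 2 * (b * hsNorm H)),
        sq_nonneg (hsNorm (H ^ 2) - b ^ 2), sq_nonneg (2 * (b * hsNorm H) - b ^ 2)]
    have h5 : b ^ 2 * hsNorm H ^ 2 ≤ b ^ 2 * (b * N) := mul_le_mul_of_nonneg_left B1 (by positivity)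
    have hNN : N ≤ N ^ 2 := by nlinarith
    have h6 : b ^ 3 * N ≤ b ^ 4 * N ^ 2 :=
      mul_le_mul (pow_le_pow_right₀ hb (by norm_num)) hNN hN0 (by positivity)
    have h7 : b ^ 3 * N ^ 2 ≤ b ^ 4 * N ^ 2 :=
      mul_le_mul_of_nonneg_right (pow_le_pow_right₀ hb (by norm_num)) (by positivity)
    have h8 : b ^ 4 ≤ b ^ 4 * N ^ 2 := le_mul_of_one_le_right (by positivity) (hN.trans hNN)
    linarith
  calc hsNorm (H ^ 3) ^ 2 ≤ N * (5 * b * (51 * b ^ 4 * N ^ 2)) := by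
        refine h2.trans (mul_le_mul_of_nonneg_left (h1.trans ?_) hN0)
        exact mul_le_mul_of_nonneg_left h3 (by positivity)
    _ = 255 * b ^ 5 * N ^ 3 := by ring

end HilbertSchmidt

section Hamiltonian

variable {dloc : ℕ}

theorem isHermitian_Ham {k N : ℕ} [NeZero N] (hk : k ≤ N) {h : Op dloc k} (hh : h.IsHermitian) :
    (Ham dloc k N h).IsHermitian := by
  rw [Ham_eq_sum hk]
  refine isSelfAdjoint_sum _ fun l _ => ?_
  rw [← placeHom_apply _ (interval_injective hk l)]
  exact IsSelfAdjoint.map (show IsSelfAdjoint h from hh) (placeHom _ _)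

section
open scoped Matrix.Norms.L2Operator

theorem opNorm_Ham_le {k N : ℕ} [NeZero N] (hk : k ≤ N) {h : Op dloc k} (hh : opNorm h ≤ 1) :
    opNorm (Ham dloc k N h) ≤ N := by
  rw [Ham_eq_sum hk, opNorm_eq_norm]
  refine (norm_sum_le _ _).trans ?_
  refine (Finset.sum_le_sum fun l _ =>
    (opNorm_place_le _ (interval_injective hk l) h).trans hh).trans ?_
  simp

end

theorem exists_hsNorm_Ham_pow_le [NeZero dloc] {k : ℕ} {h : Op dloc k} (hh : h.IsHermitian)
    (htr : h.trace = 0) (hnorm : opNorm h ≤ 1) :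
    ∃ K : ℝ, 1 ≤ K ∧ ∀ (N : ℕ) [NeZero N], 5 * k + 1 ≤ N → ∀ p ≤ 3,
      hsNorm (Ham dloc k N h ^ p) ^ 2 ≤ K * (N : ℝ) ^ p := by
  set b : ℝ := max 1 (opNorm (windowHam k k h)) with hb
  have hb1 : 1 ≤ b := le_max_left _ _
  have hpow : ∀ m : ℕ, 1 ≤ b ^ m := fun m => one_le_pow₀ hb1
  refine ⟨255 * b ^ 5, by linarith [hpow 5], fun N _ hN p hp => ?_⟩
  have hN' : 4 * k + k + 1 ≤ N := by omega
  have hN1 : (1 : ℝ) ≤ N := by exact_mod_cast (by omega : 1 ≤ N)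
  have hinj : Function.Injective (interval k N 0) := interval_injective (by omega) 0
  have hu : embed dloc k N h = place (interval k N 0) h := embed_eq_place (by omega) h
  have haway := awayFrom_farHam hN' h
  obtain ⟨h1, h2, h3⟩ := hsNorm_pow_bounds (H := Ham dloc k N h) (u := embed dloc k N h) hN1 hb1
    (isHermitian_Ham (by omega) hh) (Ham_eq_window_add_far hN' h)
    ((opNorm_place_le _ (interval_injective hN' _) _).trans (le_max_right _ _))
    (by rw [hu]; exact (opNorm_place_le _ hinj h).trans hnorm)
    (by rw [hu]; exact haway.commute hinj h)
    (fun n => by rw [hu]; exact (haway.pow n).ntr_place_mul_eq_zero hinj htr)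
    (fun n => by simpa using ntr_Ham_pow_succ (show k ≤ N by omega) h n)
  have b15 : b ≤ b ^ 5 := le_self_pow₀ hb1 (by norm_num)
  have b35 : b ^ 3 ≤ b ^ 5 := pow_le_pow_right₀ hb1 (by norm_num)
  interval_cases p
  · rw [pow_zero, pow_zero, mul_one]
    have := pow_le_one₀ (n := 2) (hsNorm_nonneg _)
      (hsNorm_one_le (n := Fin N → Fin dloc))
    linarith [hpow 5]
  · rw [pow_one, pow_one]
    refine h1.trans (mul_le_mul_of_nonneg_right ?_ (by positivity))
    linarith [hpow 5]
  · refine h2.trans (mul_le_mul_of_nonneg_right ?_ (by positivity))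
    linarith [hpow 5]
  · exact h3

end Hamiltonian

section Spectral

variable {dloc N : ℕ} {H : Op dloc N} (D : EigData dloc N H)

theorem trace_eq_sum_eev (X : Op dloc N) : X.trace = ∑ j, eev D X j := by
  set V : Op dloc N := Matrix.of fun x j => D.v j x with hV
  have h1 : Vᴴ * V = 1 := by
    ext j j'
    rw [Matrix.one_apply, ← D.orth j j']
    rfl
  have h2 : V * Vᴴ = 1 := mul_eq_one_comm.mp h1
  have h3 : X.trace = (Vᴴ * (X * V)).trace := by
    rw [Matrix.trace_mul_comm, mul_assoc, h2, mul_one]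
  rw [h3]
  rfl

theorem pow_mulVec_eigenvector (p : ℕ) (j : Fin N → Fin dloc) :
    (H ^ p).mulVec (D.v j) = ((D.E j : ℂ) ^ p) • D.v j := by
  induction p with
  | zero => simp
  | succ p ih => rw [pow_succ, ← Matrix.mulVec_mulVec, D.eigH, Matrix.mulVec_smul, ih, smul_smul,
      pow_succ']

theorem eev_mul_pow (X : Op dloc N) (p : ℕ) (j : Fin N → Fin dloc) :
    eev D (X * H ^ p) j = (D.E j : ℂ) ^ p * eev D X j := by
  rw [eev, ← Matrix.mulVec_mulVec, pow_mulVec_eigenvector, Matrix.mulVec_smul, dotProduct_smul,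
    smul_eq_mul, eev]

theorem ntr_pow_mul_eq (X : Op dloc N) (p : ℕ) :
    ntr (H ^ p * X) = (∑ j, (D.E j : ℂ) ^ p * eev D X j) / (dloc : ℂ) ^ N := by
  rw [ntr_mul_comm, ntr_apply, trace_eq_sum_eev D, Fintype.card_fin, Fintype.card_fin]
  simp only [eev_mul_pow]

theorem ntr_pow_eq (p : ℕ) :
    ntr (H ^ p) = (∑ j, (D.E j : ℂ) ^ p) / (dloc : ℂ) ^ N := by
  have h1 := ntr_pow_mul_eq D 1 p
  have h2 : ∀ j, eev D 1 j = 1 := fun j => by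
    rw [eev, Matrix.one_mulVec, D.orth, if_pos rfl]
  simpa only [mul_one, h2] using h1

theorem hsNorm_pow_sq_eq (hH : H.IsHermitian) (p : ℕ) :
    hsNorm (H ^ p) ^ 2 = (∑ j, D.E j ^ (2 * p)) / (dloc : ℝ) ^ N := by
  have h1 := ntr_conjTranspose_mul_self (H ^ p)
  rw [(hH.pow p).eq, ← pow_add, ntr_pow_eq D, ← two_mul] at h1
  exact_mod_cast h1.symm

section
open scoped Matrix.Norms.L2Operator

theorem abs_eigenvalue_le_opNorm (j : Fin N → Fin dloc) : |D.E j| ≤ opNorm H := by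
  have h1 := Matrix.l2_opNorm_mulVec H (WithLp.toLp 2 (D.v j))
  have h2 : (EuclideanSpace.equiv (Fin N → Fin dloc) ℂ).symm (H.mulVec (D.v j)) =
      (D.E j : ℂ) • WithLp.toLp 2 (D.v j) := by
    rw [D.eigH]
    rfl
  have h3 : 0 < ‖(WithLp.toLp 2 (D.v j) : EuclideanSpace ℂ (Fin N → Fin dloc))‖ := by
    rw [norm_pos_iff]
    intro h0
    have h4 : D.v j = 0 := congrArg WithLp.ofLp h0
    have h5 := D.orth j j
    rw [h4, if_pos rfl] at h5
    simp at h5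
  have h6 : ‖(D.E j : ℂ) • (WithLp.toLp 2 (D.v j) : EuclideanSpace ℂ (Fin N → Fin dloc))‖ ≤
      opNorm H * ‖(WithLp.toLp 2 (D.v j) : EuclideanSpace ℂ (Fin N → Fin dloc))‖ := by
    rw [← h2]
    exact h1
  rw [norm_smul, Complex.norm_real, Real.norm_eq_abs] at h6
  exact le_of_mul_le_mul_right h6 h3

end

/-- Odd absolute moments are controlled by the neighbouring even ones. -/
theorem sum_abs_odd_pow_le (hH : H.IsHermitian) (q : ℕ) {t : ℝ} (ht : 0 < t) :
    (∑ j, |D.E j| ^ (2 * q + 1)) / (dloc : ℝ) ^ N ≤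
      (t * hsNorm (H ^ q) ^ 2 + hsNorm (H ^ (q + 1)) ^ 2 / t) / 2 := by
  rw [hsNorm_pow_sq_eq D hH, hsNorm_pow_sq_eq D hH]
  have h1 : ∀ j, |D.E j| ^ (2 * q + 1) ≤
      (t * D.E j ^ (2 * q) + D.E j ^ (2 * (q + 1)) / t) / 2 := by
    intro j
    have h2 : |D.E j| ≤ (t + |D.E j| ^ 2 / t) / 2 := by
      rw [le_div_iff₀ two_pos, ← sub_nonneg]
      have : t + |D.E j| ^ 2 / t - |D.E j| * 2 = (t - |D.E j|) ^ 2 / t := by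
        field_simp
        ring
      rw [this]
      positivity
    have h3 : ∀ m : ℕ, D.E j ^ (2 * m) = |D.E j| ^ (2 * m) := fun m => by
      rw [pow_mul, pow_mul, sq_abs]
    rw [h3, h3, pow_succ]
    calc |D.E j| ^ (2 * q) * |D.E j| ≤ |D.E j| ^ (2 * q) * ((t + |D.E j| ^ 2 / t) / 2) :=
          mul_le_mul_of_nonneg_left h2 (by positivity)
      _ = _ := by ring
  calc _ ≤ (∑ j, (t * D.E j ^ (2 * q) + D.E j ^ (2 * (q + 1)) / t) / 2) / (dloc : ℝ) ^ N := by
        gcongr with j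
        exact h1 j
    _ = _ := by
        rw [← Finset.sum_div, Finset.sum_add_distrib, ← Finset.mul_sum, ← Finset.sum_div]
        ring

theorem norm_ntr_sub_taylor_le (hH : H.IsHermitian) (hN : 0 < N) (hE : ∀ j, |D.E j| ≤ N)
    (A : Op dloc N) {f : ℝ → ℂ} {c0 c1 c2 : ℂ} {M : ℝ} (hf : SmoothFn f c0 c1 c2 M) (p : ℕ) :
    ‖ntr (H ^ p * A) - c0 * ntr (H ^ p) - c1 / N * ntr (H ^ (p + 1)) -
        c2 / 2 / N ^ 2 * ntr (H ^ (p + 2))‖ ≤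
      M / N ^ 3 * ((∑ j, |D.E j| ^ (p + 3)) / (dloc : ℝ) ^ N) + hsNorm (H ^ p) * rf D A f := by
  have hN0 : (0 : ℝ) < N := by exact_mod_cast hN
  have hNC : (N : ℂ) ≠ 0 := by exact_mod_cast hN.ne'
  have e1 : ntr (H ^ p * A) - c0 * ntr (H ^ p) - c1 / N * ntr (H ^ (p + 1)) -
        c2 / 2 / N ^ 2 * ntr (H ^ (p + 2)) =
      (∑ j, (D.E j : ℂ) ^ p * (eev D A j - c0 - c1 * ((D.E j / N : ℝ) : ℂ) -
        c2 / 2 * ((D.E j / N : ℝ) : ℂ) ^ 2)) / (dloc : ℂ) ^ N := by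
    simp only [ntr_pow_mul_eq D, ntr_pow_eq D, mul_div_assoc', Finset.mul_sum, ← sub_div,
      ← Finset.sum_sub_distrib]
    congr 1
    refine Finset.sum_congr rfl fun j _ => ?_
    push_cast
    field_simp
    ring
  have e2 : ∀ j, ‖(D.E j : ℂ) ^ p * (eev D A j - c0 - c1 * ((D.E j / N : ℝ) : ℂ) -
        c2 / 2 * ((D.E j / N : ℝ) : ℂ) ^ 2)‖ ≤
      M / N ^ 3 * |D.E j| ^ (p + 3) + |D.E j| ^ p * ‖eev D A j - f (D.E j / N)‖ := by
    intro j
    have hx : D.E j / N ∈ Set.Icc (-1 : ℝ) 1 := by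
      rw [Set.mem_Icc, ← abs_le, abs_div, abs_of_pos hN0, div_le_one hN0]
      exact hE j
    have h1 := hf.2.2 _ hx
    rw [norm_mul, norm_pow, Complex.norm_real, Real.norm_eq_abs]
    have h2 : eev D A j - c0 - c1 * ((D.E j / N : ℝ) : ℂ) -
        c2 / 2 * ((D.E j / N : ℝ) : ℂ) ^ 2 = (eev D A j - f (D.E j / N)) +
        (f (D.E j / N) - c0 - c1 * ((D.E j / N : ℝ) : ℂ) -
          c2 / 2 * ((D.E j / N : ℝ) : ℂ) ^ 2) := by ring
    rw [h2]
    calc _ ≤ |D.E j| ^ p * (‖eev D A j - f (D.E j / N)‖ + M * |D.E j / N| ^ 3) :=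
          mul_le_mul_of_nonneg_left ((norm_add_le _ _).trans (add_le_add le_rfl h1))
            (by positivity)
      _ = _ := by
          rw [abs_div, abs_of_pos hN0]
          ring
  have e3 : (∑ j, |D.E j| ^ p * ‖eev D A j - f (D.E j / N)‖) / (dloc : ℝ) ^ N ≤
      hsNorm (H ^ p) * rf D A f := by
    have h1 : hsNorm (H ^ p) = √((∑ j, (|D.E j| ^ p) ^ 2) / (dloc : ℝ) ^ N) := by
      rw [← Real.sqrt_sq (hsNorm_nonneg (H ^ p)), hsNorm_pow_sq_eq D hH]
      congr 2
      refine Finset.sum_congr rfl fun j _ => ?_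
      rw [pow_mul, ← sq_abs, ← pow_mul, ← pow_mul, mul_comm]
    rw [h1, rf, ← Real.sqrt_mul (by positivity), one_div, inv_mul_eq_div, div_mul_div_comm,
      Real.sqrt_div (by positivity), Real.sqrt_mul_self (by positivity),
      Real.sqrt_mul (by positivity)]
    gcongr
    exact Real.sum_mul_le_sqrt_mul_sqrt _ _ _
  rw [e1, norm_div, norm_pow, Complex.norm_natCast]
  calc _ ≤ (∑ j, (M / N ^ 3 * |D.E j| ^ (p + 3) + |D.E j| ^ p * ‖eev D A j - f (D.E j / N)‖)) /
          (dloc : ℝ) ^ N := by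
        gcongr
        exact (norm_sum_le _ _).trans (Finset.sum_le_sum fun j _ => e2 j)
    _ ≤ _ := by
        rw [Finset.sum_add_distrib, add_div, ← Finset.mul_sum, mul_div_assoc]
        gcongr

end Spectral

section Limits

theorem eq_zero_of_norm_natCast_mul_add_le {n : ℕ → ℕ} {δ : ℕ → ℝ} {c s : ℂ}
    (hn : Tendsto n atTop atTop) (hδ : Tendsto δ atTop (nhds 0))
    (h : ∀ᶠ i in atTop, ‖(n i : ℂ) * c + s‖ ≤ δ i) : c = 0 ∧ s = 0 := by
  have h1 : Tendsto (fun i => (n i : ℂ) * c + s) atTop (nhds 0) := squeeze_zero_norm' h hδ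
  have h2 : Tendsto (fun i => ((n i : ℂ))⁻¹) atTop (nhds 0) :=
    (tendsto_inv_atTop_nhds_zero_nat (𝕜 := ℂ)).comp hn
  have h3 : Tendsto (fun _ : ℕ => c) atTop (nhds 0) := by
    have h4 := (h2.mul h1).sub (h2.mul_const s)
    simp only [mul_zero, zero_mul, sub_zero] at h4
    refine h4.congr' ?_
    filter_upwards [hn.eventually_ge_atTop 1] with i hi
    have : (n i : ℂ) ≠ 0 := by exact_mod_cast (by omega : n i ≠ 0)
    field_simp
    ring
  have hc : c = 0 := tendsto_nhds_unique tendsto_const_nhds h3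
  subst hc
  simp only [mul_zero, zero_add] at h1
  exact ⟨rfl, tendsto_nhds_unique tendsto_const_nhds h1⟩

theorem eq_zero_of_norm_add_div_natCast_le {n : ℕ → ℕ} {δ : ℕ → ℝ} {a s : ℂ}
    (hn : Tendsto n atTop atTop) (hδ : Tendsto δ atTop (nhds 0))
    (h : ∀ᶠ i in atTop, ‖a + s * (n i : ℂ)⁻¹‖ ≤ δ i) : a = 0 := by
  have h1 : Tendsto (fun i => a + s * (n i : ℂ)⁻¹) atTop (nhds 0) := squeeze_zero_norm' h hδ
  have h2 : Tendsto (fun i => ((n i : ℂ))⁻¹) atTop (nhds 0) :=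
    (tendsto_inv_atTop_nhds_zero_nat (𝕜 := ℂ)).comp hn
  have h3 := h1.sub (h2.const_mul s)
  simp only [add_sub_cancel_right, mul_zero, sub_zero] at h3
  exact tendsto_nhds_unique tendsto_const_nhds h3

end Limits

section Remainder

/-- The error terms of the second-order expansions of `tr (H ^ p * A)` for `p = 0, 1, 2`, for a
Hamiltonian whose moments grow diffusively with the chain length. -/
theorem taylor_remainder_le {dloc N : ℕ} {H : Op dloc N} (D : EigData dloc N H)
    (hH : H.IsHermitian) (hN : 1 ≤ N) {K M r : ℝ} (hK : 1 ≤ K) (hM : 0 ≤ M) (hr : 0 ≤ r)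
    (hmom : ∀ p ≤ 3, hsNorm (H ^ p) ^ 2 ≤ K * (N : ℝ) ^ p) :
    (N * (M / N ^ 3 * ((∑ j, |D.E j| ^ (0 + 3)) / (dloc : ℝ) ^ N) + hsNorm (H ^ 0) * r) ≤
        K * (M * (√N)⁻¹ + N * r)) ∧
      (M / N ^ 3 * ((∑ j, |D.E j| ^ (1 + 3)) / (dloc : ℝ) ^ N) + hsNorm (H ^ 1) * r ≤
        K * (M * (√N)⁻¹ + N * r)) ∧
      (M / N ^ 3 * ((∑ j, |D.E j| ^ (2 + 3)) / (dloc : ℝ) ^ N) + hsNorm (H ^ 2) * r ≤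
        K * (M * (√N)⁻¹ + N * r)) := by
  have hN1 : (1 : ℝ) ≤ N := by exact_mod_cast hN
  have hs1 : 1 ≤ √(N : ℝ) := Real.one_le_sqrt.mpr hN1
  have hsq : (N : ℝ) = √(N : ℝ) ^ 2 := (Real.sq_sqrt (by positivity)).symm
  set s : ℝ := √(N : ℝ) with hs
  have hs0 : 0 < s := by linarith
  have hnorm : ∀ p ≤ 2, hsNorm (H ^ p) ≤ K * N := fun p hp => by
    refine abs_le_of_sq_le_sq' ?_ (by positivity) |>.2
    calc hsNorm (H ^ p) ^ 2 ≤ K * (N : ℝ) ^ p := hmom p (by omega)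
      _ ≤ K ^ 2 * (N : ℝ) ^ 2 := by
          gcongr
          exact le_self_pow₀ hK two_ne_zero
      _ = (K * N) ^ 2 := by ring
  have hodd : ∀ q, q ≤ 2 → (∑ j, |D.E j| ^ (2 * q + 1)) / (dloc : ℝ) ^ N ≤
      K * N ^ q * s := fun q hq => by
    refine (sum_abs_odd_pow_le D hH q hs0).trans ?_
    calc _ ≤ (s * (K * (N : ℝ) ^ q) + K * (N : ℝ) ^ (q + 1) / s) / 2 := by
          gcongr
          · exact hmom q (by omega)
          · exact hmom (q + 1) (by omega)
      _ = K * (N : ℝ) ^ q * s := by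
          rw [pow_succ (N : ℝ), show K * ((N : ℝ) ^ q * N) / s = K * (N : ℝ) ^ q * s by
            rw [div_eq_iff hs0.ne']
            nth_rewrite 2 [hsq]
            ring]
          ring
  have heven : (∑ j, |D.E j| ^ 4) / (dloc : ℝ) ^ N ≤ K * N ^ 2 := by
    have h1 := hmom 2 (by norm_num)
    rw [hsNorm_pow_sq_eq D hH] at h1
    simpa only [Even.pow_abs (show Even 4 by decide)] using h1
  refine ⟨?_, ?_, ?_⟩
  · calc _ ≤ N * (M / N ^ 3 * (K * N ^ 1 * s) + 1 * r) := by
          gcongr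
          · exact hodd 1 (by norm_num)
          · rw [pow_zero]
            exact hsNorm_one_le
      _ = K * (M * s⁻¹) + N * r := by
          rw [hsq]
          field_simp
      _ ≤ K * (M * s⁻¹) + K * (N * r) := by
          exact add_le_add le_rfl (le_mul_of_one_le_left (by positivity) hK)
      _ = _ := by ring
  · calc _ ≤ M / N ^ 3 * (K * N ^ 2 * s) + K * N * r := by
          gcongr
          · exact heven.trans (le_mul_of_one_le_right (by positivity) hs1)
          · exact hnorm 1 (by norm_num)
      _ = K * (M * s⁻¹) + K * N * r := by
          rw [hsq]
          field_simp
      _ = _ := by ring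
  · calc _ ≤ M / N ^ 3 * (K * N ^ 2 * s) + K * N * r := by
          gcongr
          · exact hodd 2 le_rfl
          · exact hnorm 2 le_rfl
      _ = K * (M * s⁻¹) + K * N * r := by
          rw [hsq]
          field_simp
      _ = _ := by ring

end Remainder

theorem exists_ntr_Ham_mul_embed_eq {dloc k k' : ℕ} [NeZero dloc] (h : Op dloc k)
    (htr : h.trace = 0) (A : Op dloc k') (hA : A.trace = 0) :
    ∃ α β : ℂ, ∀ N, 4 * k + k' + 1 ≤ N → ntr (Ham dloc k N h * embed dloc k' N A) = α ∧
      ntr (Ham dloc k N h ^ 2 * embed dloc k' N A) = β := by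
  refine ⟨ntr (windowHam k k' h * place (interval k' (4 * k + k' + 1) (2 * k)) A),
    ntr (windowHam k k' h ^ 2 * place (interval k' (4 * k + k' + 1) (2 * k)) A), fun N hN => ?_⟩
  have : NeZero N := ⟨by omega⟩
  exact ⟨ntr_Ham_mul_embed hN h A hA, ntr_Ham_sq_mul_embed hN h htr A hA⟩

/-- If `A` is traceless with `‖A‖ = 1`, `f` is smooth, and `N_i r_f(N_i) → 0`
along a strictly increasing sequence `N_i`, then for all sufficiently large `N`,
`(tr(H_N h)/d)(tr(H_N² A)/d) = (tr(H_N² h)/d)(tr(H_N A)/d)`. -/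
theorem trace_identity_of_fast_convergence (dloc k k' : ℕ) (hdloc : 2 ≤ dloc) (hk : 1 ≤ k)
    (h : Op dloc k) (hherm : h.IsHermitian) (htr : h.trace = 0) (hnorm : opNorm h = 1)
    (D : ∀ N, EigData dloc N (Ham dloc k N h))
    (A : Op dloc k') (hAtr : A.trace = 0) (hAnorm : opNorm A = 1)
    (f : ℝ → ℂ) (c0 c1 c2 : ℂ) (M : ℝ) (hf : SmoothFn f c0 c1 c2 M)
    (Ni : ℕ → ℕ) (hmono : StrictMono Ni)
    (hlim : Filter.Tendsto
      (fun i => (Ni i : ℝ) * rf (D (Ni i)) (embed dloc k' (Ni i) A) f)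
      Filter.atTop (nhds 0)) :
    ∃ N₀ : ℕ, ∀ N : ℕ, N₀ ≤ N →
      ((Ham dloc k N h * embed dloc k N h).trace / (dloc : ℂ) ^ N) *
          ((Ham dloc k N h ^ 2 * embed dloc k' N A).trace / (dloc : ℂ) ^ N) =
        ((Ham dloc k N h ^ 2 * embed dloc k N h).trace / (dloc : ℂ) ^ N) *
          ((Ham dloc k N h * embed dloc k' N A).trace / (dloc : ℂ) ^ N) := by
  have : NeZero dloc := ⟨by omega⟩
  obtain ⟨K, hK1, hK⟩ := exists_hsNorm_Ham_pow_le hherm htr hnorm.le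
  obtain ⟨σ, μ, hσμ⟩ := exists_ntr_Ham_mul_embed_eq h htr h htr
  obtain ⟨α, β, hαβ⟩ := exists_ntr_Ham_mul_embed_eq h htr A hAtr
  have hσ : ∀ N, 5 * k + k' + 1 ≤ N → ntr (Ham dloc k N h * embed dloc k N h) = σ :=
    fun N hN => (hσμ N (by omega)).1
  have hμ : ∀ N, 5 * k + k' + 1 ≤ N → ntr (Ham dloc k N h ^ 2 * embed dloc k N h) = μ :=
    fun N hN => (hσμ N (by omega)).2
  have hα : ∀ N, 5 * k + k' + 1 ≤ N → ntr (Ham dloc k N h * embed dloc k' N A) = α :=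
    fun N hN => (hαβ N (by omega)).1
  have hβ : ∀ N, 5 * k + k' + 1 ≤ N → ntr (Ham dloc k N h ^ 2 * embed dloc k' N A) = β :=
    fun N hN => (hαβ N (by omega)).2
  have hembed : ∀ {m N : ℕ} {a : Op dloc m}, m ≤ N → a.trace = 0 → 1 ≤ N →
      ntr (embed dloc m N a) = 0 := fun {m N a} hm ha hN => by
    have : NeZero N := ⟨by omega⟩
    rw [embed_eq_place hm, ntr_place _ (interval_injective hm 0), ntr_apply, ha, zero_div]
  have hmom : ∀ N, 5 * k + k' + 1 ≤ N → ntr (Ham dloc k N h ^ 1) = 0 ∧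
      ntr (Ham dloc k N h ^ 2) = N * σ ∧ ntr (Ham dloc k N h ^ 3) = N * μ := fun N hN => by
    have : NeZero N := ⟨by omega⟩
    have hkN : k ≤ N := by omega
    refine ⟨?_, ?_, ?_⟩
    · rw [ntr_Ham_pow_succ hkN h 0, pow_zero, one_mul, hembed hkN htr (by omega), mul_zero]
    · rw [ntr_Ham_pow_succ hkN h 1, pow_one, hσ N hN]
    · rw [ntr_Ham_pow_succ hkN h 2, hμ N hN]
  have hmain : σ * β = μ * α := by
    have hn : Tendsto Ni atTop atTop := hmono.tendsto_atTop
    set δ : ℕ → ℝ := fun i => K * (M * (√(Ni i : ℝ))⁻¹ +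
      Ni i * rf (D (Ni i)) (embed dloc k' (Ni i) A) f) with hδ
    have hδ0 : Tendsto δ atTop (nhds 0) := by
      have h1 : Tendsto (fun i => (√(Ni i : ℝ))⁻¹) atTop (nhds 0) :=
        tendsto_inv_atTop_zero.comp
          (Real.tendsto_sqrt_atTop.comp (tendsto_natCast_atTop_atTop.comp hn))
      simpa using ((h1.const_mul M).add hlim).const_mul K
    have hev : ∀ᶠ i in atTop, 5 * k + k' + 1 ≤ Ni i := hn.eventually_ge_atTop _
    have hexp : ∀ N, 5 * k + k' + 1 ≤ N → ∀ p,
        ‖ntr (Ham dloc k N h ^ p * embed dloc k' N A) - c0 * ntr (Ham dloc k N h ^ p) -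
          c1 / N * ntr (Ham dloc k N h ^ (p + 1)) -
          c2 / 2 / N ^ 2 * ntr (Ham dloc k N h ^ (p + 2))‖ ≤
        M / N ^ 3 * ((∑ j, |(D N).E j| ^ (p + 3)) / (dloc : ℝ) ^ N) +
          hsNorm (Ham dloc k N h ^ p) * rf (D N) (embed dloc k' N A) f := fun N hN p => by
      have : NeZero N := ⟨by omega⟩
      exact norm_ntr_sub_taylor_le (D N) (isHermitian_Ham (by omega) hherm) (by omega)
        (fun j => (abs_eigenvalue_le_opNorm (D N) j).trans
          (opNorm_Ham_le (by omega) hnorm.le)) _ hf p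
    have hrem : ∀ N, 5 * k + k' + 1 ≤ N → _ := fun N hN =>
      haveI : NeZero N := ⟨by omega⟩
      taylor_remainder_le (D N) (isHermitian_Ham (by omega) hherm) (by omega) hK1 hf.1
        (r := rf (D N) (embed dloc k' N A) f) (Real.sqrt_nonneg _) (hK N (by omega))
    obtain ⟨hc0, hs⟩ : -c0 = 0 ∧ -(c2 / 2 * σ) = 0 := by
      refine eq_zero_of_norm_natCast_mul_add_le hn hδ0 ?_
      filter_upwards [hev] with i hi
      have hn0 : (Ni i : ℂ) ≠ 0 := by exact_mod_cast (by omega : Ni i ≠ 0)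
      refine le_trans ?_ ((mul_le_mul_of_nonneg_left (hexp _ hi 0) (Nat.cast_nonneg _)).trans
        (hrem _ hi).1)
      rw [← Complex.norm_natCast, ← norm_mul, pow_zero, one_mul,
        hembed (by omega) hAtr (by omega), ntr_one, zero_add, zero_add, (hmom _ hi).1,
        (hmom _ hi).2.1]
      refine le_of_eq (congrArg _ ?_)
      field_simp
      ring
    have hc0' : c0 = 0 := neg_eq_zero.mp hc0
    have hα1 : α - c1 * σ = 0 := by
      refine eq_zero_of_norm_add_div_natCast_le (s := -(c2 / 2 * μ)) hn hδ0 ?_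
      filter_upwards [hev] with i hi
      have hn0 : (Ni i : ℂ) ≠ 0 := by exact_mod_cast (by omega : Ni i ≠ 0)
      refine le_trans (le_of_eq (congrArg _ ?_)) ((hexp _ hi 1).trans (hrem _ hi).2.1)
      rw [(hmom _ hi).1, (hmom _ hi).2.1, (hmom _ hi).2.2, pow_one, hα _ hi]
      field_simp
      ring
    by_cases hσ0 : σ = 0
    · have hα0 : α = 0 := by
        rw [hσ0, mul_zero, sub_zero] at hα1
        exact hα1
      rw [hσ0, hα0, zero_mul, mul_zero]
    · have hc2 : c2 = 0 := by simpa [hσ0] using hs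
      have hβ1 : β - c1 * μ = 0 := by
        refine eq_zero_of_norm_add_div_natCast_le (s := 0) hn hδ0 ?_
        filter_upwards [hev] with i hi
        have hn0 : (Ni i : ℂ) ≠ 0 := by exact_mod_cast (by omega : Ni i ≠ 0)
        refine le_trans (le_of_eq (congrArg _ ?_)) ((hexp _ hi 2).trans (hrem _ hi).2.2)
        rw [(hmom _ hi).2.2, hβ _ hi, hc0', hc2]
        field_simp
        ring
      rw [sub_eq_zero.mp hα1, sub_eq_zero.mp hβ1]
      ring
  refine ⟨5 * k + k' + 1, fun N hN => ?_⟩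
  have h1 : ∀ X : Op dloc N, X.trace / (dloc : ℂ) ^ N = ntr X := fun X => by
    rw [ntr_apply, Fintype.card_fin, Fintype.card_fin]
  rw [h1, h1, h1, h1, hσ N hN, hμ N hN, hα N hN, hβ N hN, hmain]
end

section
/- (Weak eigenstate thermalization hypothesis.) There is a constant C, depending only on d_loc and k', such that the following holds: for every N ≥ k', every traceless operator A on the first k' sites with ‖A‖ ≤ 1, and every orthonormal basis {|j⟩}_{j=1}^{d} of (ℂ^{d_loc})^{⊗N} consisting of eigenvectors of the translation operator T, one has (1/d) Σ_{j=1}^{d} |⟨j|A|j⟩|² ≤ C/N. -/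
open Matrix MeasureTheory Filter

/-- The operator on the whole chain acting as `a` on the sites `ι 0, …, ι (m - 1)` and as the
identity elsewhere. -/
noncomputable def embedAt {dloc m N : ℕ} (ι : Fin m → Fin N) (a : Op dloc m) : Op dloc N :=
  open Classical in
  fun x y => a (x ∘ ι) (y ∘ ι) * (if ∀ i ∉ Set.range ι, x i = y i then 1 else 0)

/-- The window of `m` consecutive sites starting at site `l`. -/
def window {m n : ℕ} (hm : m ≤ n + 1) (l : Fin (n + 1)) (i : Fin m) : Fin (n + 1) :=
  Fin.castLE hm i + l

lemma window_injective {m n : ℕ} (hm : m ≤ n + 1) (l : Fin (n + 1)) :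
    Function.Injective (window hm l) := by
  intro i j h
  exact Fin.castLE_injective hm (add_right_cancel h)

open Fin.NatCast in
lemma confShift_symm_iterate (dloc n l : ℕ) (x : Fin (n + 1) → Fin dloc) (i : Fin (n + 1)) :
    ((confShift dloc (n + 1)).symm^[l] x) i = x (i + (l : Fin (n + 1))) := by
  induction l generalizing x with
  | zero => simp
  | succ l ih =>
    rw [Function.iterate_succ_apply, ih]
    simp [confShift, Equiv.arrowCongr, add_assoc]

lemma embed_apply {dloc m N : ℕ} (hm : m ≤ N) (a : Op dloc m) (x y : Fin N → Fin dloc) :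
    embed dloc m N a x y = a (fun i => x (Fin.castLE hm i)) (fun i => y (Fin.castLE hm i)) *
      (if ∀ i : Fin N, m ≤ (i : ℕ) → x i = y i then 1 else 0) :=
  congrFun (congrFun (dif_pos hm : embed dloc m N a = _) x) y

open Fin.NatCast in
lemma embed_confShift_symm_iterate {dloc m n : ℕ} (hm : m ≤ n + 1) (a : Op dloc m)
    (l : Fin (n + 1)) (x y : Fin (n + 1) → Fin dloc) :
    embed dloc m (n + 1) a ((confShift dloc (n + 1)).symm^[(l : ℕ)] x)
      ((confShift dloc (n + 1)).symm^[(l : ℕ)] y) = embedAt (window hm l) a x y := by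
  have hl : ((l : ℕ) : Fin (n + 1)) = l := Fin.cast_val_eq_self l
  simp only [embed_apply hm, embedAt, confShift_symm_iterate, hl]
  congr 1
  refine if_congr ⟨fun h i hi => ?_, fun h i hi => ?_⟩ rfl rfl
  · have := h (i - l) (by
      by_contra hlt
      refine hi ⟨⟨(i - l : Fin (n + 1)), by omega⟩, ?_⟩
      simp [window, Fin.castLE])
    simpa using this
  · refine h _ ?_
    rintro ⟨j, hj⟩
    have := congrArg Fin.val (add_right_cancel hj)
    simp at this
    omega

lemma Tmat_mulVec (dloc N : ℕ) (v : (Fin N → Fin dloc) → ℂ) (x : Fin N → Fin dloc) :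
    (Tmat dloc N *ᵥ v) x = v ((confShift dloc N).symm x) := by
  simp only [Matrix.mulVec, dotProduct, Tmat]
  rw [Finset.sum_eq_single ((confShift dloc N).symm x)]
  · simp
  · intro b _ hb
    rw [if_neg, zero_mul]
    rintro rfl
    simp at hb
  · simp

lemma star_dotProduct_mulVec {n : Type*} [Fintype n] (B : Matrix n n ℂ) (v : n → ℂ) :
    star v ⬝ᵥ B *ᵥ v = ∑ x, ∑ y, star (v x) * B x y * v y := by
  simp [dotProduct, Matrix.mulVec, Finset.mul_sum, mul_assoc]

lemma quadForm_shift {n : Type*} [Fintype n] (s : Equiv.Perm n) (B : Matrix n n ℂ) (v : n → ℂ)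
    (t : ℂ) (hv : star v ⬝ᵥ v = 1) (hs : ∀ x, v (s x) = t * v x) :
    star v ⬝ᵥ B *ᵥ v = star v ⬝ᵥ (Matrix.of fun x y => B (s x) (s y)) *ᵥ v := by
  have ht : star t * t = 1 := by
    have h : star v ⬝ᵥ v = (star t * t) * (star v ⬝ᵥ v) := by
      simp only [dotProduct, Pi.star_apply, Finset.mul_sum]
      rw [← Equiv.sum_comp s]
      refine Finset.sum_congr rfl fun x _ => ?_
      rw [hs, star_mul]
      ring
    rw [hv, mul_one] at h
    exact h.symm
  rw [star_dotProduct_mulVec, star_dotProduct_mulVec, ← Equiv.sum_comp s]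
  refine Finset.sum_congr rfl fun x _ => ?_
  rw [← Equiv.sum_comp s]
  refine Finset.sum_congr rfl fun y _ => ?_
  rw [hs, hs, star_mul, Matrix.of_apply]
  linear_combination (star (v x) * B (s x) (s y) * v y) * ht

lemma quadForm_shift_iterate {n : Type*} [Fintype n] (s : Equiv.Perm n) (B : Matrix n n ℂ)
    (v : n → ℂ) (t : ℂ) (hv : star v ⬝ᵥ v = 1) (hs : ∀ x, v (s x) = t * v x) (l : ℕ) :
    star v ⬝ᵥ B *ᵥ v = star v ⬝ᵥ (Matrix.of fun x y => B (s^[l] x) (s^[l] y)) *ᵥ v := by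
  induction l with
  | zero => rfl
  | succ l ih =>
    rw [ih, quadForm_shift s _ v t hv hs]
    rfl

lemma sum_norm_sq_diag_le {n : Type*} [Fintype n] [DecidableEq n] (M : Matrix n n ℂ)
    (v : n → n → ℂ) (hv : ∀ j j', star (v j) ⬝ᵥ v j' = if j = j' then 1 else 0) :
    ∑ j, ‖star (v j) ⬝ᵥ M *ᵥ (v j)‖ ^ 2 ≤ ∑ x, ∑ y, ‖M x y‖ ^ 2 := by
  have frob (K : Matrix n n ℂ) :
      ((∑ x, ∑ y, ‖K x y‖ ^ 2 : ℝ) : ℂ) = Matrix.trace (Kᴴ * K) := by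
    simp only [Matrix.trace, Matrix.diag, Matrix.mul_apply, Matrix.conjTranspose_apply]
    rw [Finset.sum_comm]
    push_cast
    refine Finset.sum_congr rfl fun x _ => Finset.sum_congr rfl fun y _ => ?_
    exact (Complex.conj_mul' _).symm
  set V : Matrix n n ℂ := Matrix.of fun x j => v j x with hV
  have h1 : Vᴴ * V = 1 := by
    ext i j
    rw [Matrix.one_apply, ← hv i j]
    rfl
  have h2 : V * Vᴴ = 1 := mul_eq_one_comm.mp h1
  have h3 : ∑ x, ∑ y, ‖M x y‖ ^ 2 = ∑ x, ∑ y, ‖(Vᴴ * M * V) x y‖ ^ 2 := by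
    have : Matrix.trace (Mᴴ * M) = Matrix.trace ((Vᴴ * M * V)ᴴ * (Vᴴ * M * V)) := by
      have e : (Vᴴ * M * V)ᴴ * (Vᴴ * M * V) = Vᴴ * (Mᴴ * (V * Vᴴ) * (M * V)) := by
        simp only [Matrix.conjTranspose_mul, Matrix.conjTranspose_conjTranspose, Matrix.mul_assoc]
      rw [e, h2, Matrix.mul_one, Matrix.trace_mul_comm Vᴴ, Matrix.mul_assoc, Matrix.mul_assoc, h2,
        Matrix.mul_one]
    rw [← frob, ← frob] at this
    exact_mod_cast this
  rw [h3]
  refine Finset.sum_le_sum fun j _ => ?_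
  have h4 : star (v j) ⬝ᵥ M *ᵥ (v j) = (Vᴴ * M * V) j j := by
    rw [Matrix.mul_assoc]
    rfl
  rw [h4]
  exact Finset.single_le_sum (f := fun y => ‖(Vᴴ * M * V) j y‖ ^ 2)
    (fun _ _ => by positivity) (Finset.mem_univ j)

lemma norm_entry_le_opNorm {n : Type*} [Fintype n] [DecidableEq n] (A : Matrix n n ℂ) (x y : n) :
    ‖A x y‖ ≤ opNorm A := by
  have h1 := (Matrix.toEuclideanCLM (𝕜 := ℂ) (n := n) A).le_opNorm (EuclideanSpace.single y 1)
  have h2 := PiLp.norm_apply_le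
    (Matrix.toEuclideanCLM (𝕜 := ℂ) (n := n) A (EuclideanSpace.single y 1)) x
  have h3 : (Matrix.toEuclideanCLM (𝕜 := ℂ) (n := n) A (EuclideanSpace.single y 1)) x = A x y := by
    simp
  rw [h3] at h2
  simpa [opNorm] using h2.trans h1

/-- A function with mean zero depending on the coordinates `ι` is orthogonal to every function
of the other coordinates. -/
lemma sum_mul_comp_eq_zero {D m N : ℕ} {ι : Fin m → Fin N} (hι : Function.Injective ι)
    (f : (Fin N → Fin D) → ℂ) (hf : ∀ x y, (∀ i ∉ Set.range ι, x i = y i) → f x = f y)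
    (g : (Fin m → Fin D) → ℂ) (hg : ∑ z, g z = 0) :
    ∑ x, f x * g (x ∘ ι) = 0 := by
  classical
  rw [← Equiv.sum_comp (Equiv.piEquivPiSubtypeProd (· ∈ Set.range ι) fun _ => Fin D).symm,
    Fintype.sum_prod_type_right]
  refine Finset.sum_eq_zero fun w _ => ?_
  rcases isEmpty_or_nonempty ({i // i ∈ Set.range ι} → Fin D) with h | ⟨⟨u₀⟩⟩
  · simp
  have key (u : {i // i ∈ Set.range ι} → Fin D) :
      f ((Equiv.piEquivPiSubtypeProd (· ∈ Set.range ι) fun _ => Fin D).symm (u, w)) =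
      f ((Equiv.piEquivPiSubtypeProd (· ∈ Set.range ι) fun _ => Fin D).symm (u₀, w)) := by
    refine hf _ _ fun i hi => ?_
    simp only [Equiv.piEquivPiSubtypeProd_symm_apply]
    rw [dif_neg hi, dif_neg hi]
  simp only [key]
  rw [← Finset.mul_sum, ← Equiv.sum_comp
    (Equiv.arrowCongr (Equiv.ofInjective ι hι) (Equiv.refl (Fin D)))]
  convert mul_zero _
  rw [← hg]
  refine Finset.sum_congr rfl fun z _ => congrArg g (funext fun i => ?_)
  simp [Equiv.piEquivPiSubtypeProd_symm_apply, Equiv.arrowCongr]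

lemma embedAt_inner_eq_zero {D m N : ℕ} {ι κ : Fin m → Fin N} (hκ : Function.Injective κ)
    (hd : ∀ i j, ι i ≠ κ j) (a : Op D m) (ha : a.trace = 0) :
    ∑ x, ∑ y, star (embedAt ι a x y) * embedAt κ a x y = 0 := by
  classical
  have h1 (x : Fin N → Fin D) : ∑ y, star (embedAt ι a x y) * embedAt κ a x y =
      star (a (x ∘ ι) (x ∘ ι)) * a (x ∘ κ) (x ∘ κ) := by
    rw [Finset.sum_eq_single x]
    · simp [embedAt]
    · intro y _ hy
      by_contra hne
      refine hy (funext fun i => ?_)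
      simp only [embedAt] at hne
      split_ifs at hne with hx hx'
      · by_cases hi : i ∈ Set.range ι
        · refine (hx' i ?_).symm
          rintro ⟨j, rfl⟩
          obtain ⟨k, hk⟩ := hi
          exact hd k j hk
        · exact (hx i hi).symm
      all_goals simp at hne
    · simp
  simp only [h1]
  refine sum_mul_comp_eq_zero hκ (fun x => star (a (x ∘ ι) (x ∘ ι))) (fun x y hxy => ?_)
    (fun z => a z z) ha
  have : x ∘ ι = y ∘ ι := funext fun i => hxy _ fun ⟨j, hj⟩ => hd i j hj.symm
  simp only [this]

lemma norm_embedAt_inner_le {D m N : ℕ} {ι κ : Fin m → Fin N} (a : Op D m)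
    (ha : ∀ x y, ‖a x y‖ ≤ 1) :
    ‖∑ x, ∑ y, star (embedAt ι a x y) * embedAt κ a x y‖ ≤ (D : ℝ) ^ N * (D : ℝ) ^ m := by
  classical
  have hle (x : Fin N → Fin D) :
      ∑ y, ‖star (embedAt ι a x y) * embedAt κ a x y‖ ≤ (D : ℝ) ^ m := by
    have h1 (y : Fin N → Fin D) : ‖star (embedAt ι a x y) * embedAt κ a x y‖ ≤
        if ∀ i ∉ Set.range ι, x i = y i then 1 else 0 := by
      have hκ : ‖embedAt κ a x y‖ ≤ 1 := by
        unfold embedAt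
        split_ifs <;> simp [ha]
      rw [norm_mul, norm_star]
      split_ifs with h
      · refine mul_le_one₀ ?_ (norm_nonneg _) hκ
        simp only [embedAt, if_pos h, mul_one, ha]
      · simp only [embedAt, if_neg h, mul_zero, norm_zero, zero_mul, le_refl]
    refine (Finset.sum_le_sum fun y _ => h1 y).trans ?_
    rw [Finset.sum_boole]
    have hcard : (Finset.univ.filter fun y : Fin N → Fin D =>
        ∀ i ∉ Set.range ι, x i = y i).card ≤ (Finset.univ : Finset (Fin m → Fin D)).card := by
      refine Finset.card_le_card_of_injOn (fun y => y ∘ ι) (fun _ _ => by simp) ?_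
      intro y hy z hz hyz
      simp only [Finset.coe_filter, Finset.mem_univ, true_and, Set.mem_ofPred_eq] at hy hz
      funext i
      by_cases hi : i ∈ Set.range ι
      · obtain ⟨j, rfl⟩ := hi
        exact congrFun hyz j
      · rw [← hy i hi, hz i hi]
    rw [Finset.card_univ, Fintype.card_fun, Fintype.card_fin, Fintype.card_fin] at hcard
    exact_mod_cast hcard
  calc _ ≤ ∑ x : Fin N → Fin D, (D : ℝ) ^ m :=
        (norm_sum_le _ _).trans (Finset.sum_le_sum fun x _ => (norm_sum_le _ _).trans (hle x))
    _ = _ := by simp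

lemma card_overlapping_windows_le {m n : ℕ} (hm : m ≤ n + 1) (l : Fin (n + 1)) :
    (Finset.univ.filter fun l' : Fin (n + 1) =>
      ∃ i j, window hm l i = window hm l' j).card ≤ m ^ 2 := by
  classical
  have hsub : (Finset.univ.filter fun l' : Fin (n + 1) => ∃ i j, window hm l i = window hm l' j) ⊆
      Finset.univ.image fun p : Fin m × Fin m => window hm l p.1 - Fin.castLE hm p.2 := by
    intro l' hl'
    obtain ⟨i, j, h⟩ := (Finset.mem_filter.mp hl').2
    refine Finset.mem_image.mpr ⟨(i, j), Finset.mem_univ _, ?_⟩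
    change window hm l i - Fin.castLE hm j = l'
    rw [h, window, add_sub_cancel_left]
  refine (Finset.card_le_card hsub).trans (Finset.card_image_le.trans ?_)
  simp [sq]

/-- The squared Frobenius norm of the sum of all translates of a traceless local operator is
linear in the length of the chain. -/
lemma frobenius_sum_translates_le {D m n : ℕ} (hm : m ≤ n + 1) (a : Op D m) (ha : a.trace = 0)
    (hle : ∀ x y, ‖a x y‖ ≤ 1) :
    ∑ x, ∑ y, ‖∑ l, embedAt (window hm l) a x y‖ ^ 2 ≤
      ((n + 1 : ℕ) : ℝ) * (m : ℝ) ^ 2 * ((D : ℝ) ^ (n + 1) * (D : ℝ) ^ m) := by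
  classical
  have expand : ((∑ x, ∑ y, ‖∑ l, embedAt (window hm l) a x y‖ ^ 2 : ℝ) : ℂ) =
      ∑ l, ∑ l', ∑ x, ∑ y, star (embedAt (window hm l) a x y) * embedAt (window hm l') a x y := by
    have h1 (x y) : (((‖∑ l, embedAt (window hm l) a x y‖ ^ 2 : ℝ)) : ℂ) =
        ∑ l, ∑ l', star (embedAt (window hm l) a x y) * embedAt (window hm l') a x y := by
      rw [← Finset.sum_mul_sum, ← star_sum]
      push_cast
      exact (Complex.conj_mul' _).symm
    push_cast at h1 ⊢
    simp only [h1]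
    calc _ = ∑ x, ∑ l, ∑ y, ∑ l',
          star (embedAt (window hm l) a x y) * embedAt (window hm l') a x y :=
          Finset.sum_congr rfl fun x _ => Finset.sum_comm
      _ = ∑ l, ∑ x, ∑ l', ∑ y,
          star (embedAt (window hm l) a x y) * embedAt (window hm l') a x y := by
          rw [Finset.sum_comm]
          exact Finset.sum_congr rfl fun l _ => Finset.sum_congr rfl fun x _ => Finset.sum_comm
      _ = _ := Finset.sum_congr rfl fun l _ => Finset.sum_comm
  have hpair (l l' : Fin (n + 1)) :
      ‖∑ x, ∑ y, star (embedAt (window hm l) a x y) * embedAt (window hm l') a x y‖ ≤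
      (if ∃ i j, window hm l i = window hm l' j then 1 else 0) *
        ((D : ℝ) ^ (n + 1) * (D : ℝ) ^ m) := by
    split_ifs with h
    · rw [one_mul]
      exact norm_embedAt_inner_le a hle
    · push Not at h
      rw [embedAt_inner_eq_zero (window_injective hm l') h a ha]
      simp
  have hnn : 0 ≤ ∑ x, ∑ y, ‖∑ l, embedAt (window hm l) a x y‖ ^ 2 := by positivity
  rw [← Complex.norm_of_nonneg hnn, expand]
  calc _ ≤ ∑ l : Fin (n + 1), ∑ l' : Fin (n + 1),
        (if ∃ i j, window hm l i = window hm l' j then (1 : ℝ) else 0) *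
          ((D : ℝ) ^ (n + 1) * (D : ℝ) ^ m) :=
        (norm_sum_le _ _).trans (Finset.sum_le_sum fun l _ =>
          (norm_sum_le _ _).trans (Finset.sum_le_sum fun l' _ => hpair l l'))
    _ ≤ ∑ l : Fin (n + 1), (m : ℝ) ^ 2 * ((D : ℝ) ^ (n + 1) * (D : ℝ) ^ m) := by
        refine Finset.sum_le_sum fun l _ => ?_
        rw [← Finset.sum_mul, Finset.sum_boole]
        gcongr
        exact_mod_cast card_overlapping_windows_le hm l
    _ = _ := by simp [mul_assoc]

/-- weak ETH: There is a constant `C` depending only on `dloc` and `k'` such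
that for every `N ≥ k'`, every traceless operator `A` on the first `k'` sites with `‖A‖ ≤ 1`,
and every orthonormal basis of eigenvectors of the translation operator `T`,
`(1/d) ∑_j |⟨j|A|j⟩|² ≤ C/N`. -/
theorem weak_eth (dloc k' : ℕ) (hdloc : 2 ≤ dloc) :
    ∃ C : ℝ, ∀ N : ℕ, k' ≤ N → ∀ A : Op dloc k', A.trace = 0 → opNorm A ≤ 1 →
      ∀ (v : (Fin N → Fin dloc) → ((Fin N → Fin dloc) → ℂ)) (τ : (Fin N → Fin dloc) → ℂ),
        (∀ j j', star (v j) ⬝ᵥ v j' = if j = j' then 1 else 0) →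
        (∀ j, (Tmat dloc N).mulVec (v j) = τ j • v j) →
        (1 / (dloc : ℝ) ^ N) * ∑ j, ‖star (v j) ⬝ᵥ (embed dloc k' N A).mulVec (v j)‖ ^ 2 ≤
          C / N := by
  refine ⟨(k' : ℝ) ^ 2 * (dloc : ℝ) ^ k', fun N hN A hA hnorm v τ hv hτ => ?_⟩
  rcases N with _ | n
  · obtain rfl : k' = 0 := by omega
    have hA0 : A = 0 := by
      ext x y
      rw [Subsingleton.elim y x]
      simpa [Matrix.trace, Subsingleton.elim x default] using hA
    have hE : embed dloc 0 0 A = 0 := by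
      ext x y
      simp [embed, hA0]
    simp [hE]
  have hle (x y) : ‖A x y‖ ≤ 1 := (norm_entry_le_opNorm A x y).trans hnorm
  set M : Op dloc (n + 1) := Matrix.of fun x y => ∑ l, embedAt (window hN l) A x y with hM
  have hquad (j) : star (v j) ⬝ᵥ M *ᵥ v j =
      ((n + 1 : ℕ) : ℂ) * (star (v j) ⬝ᵥ embed dloc k' (n + 1) A *ᵥ v j) := by
    have hMsum : M = ∑ l, embedAt (window hN l) A := by
      ext x y
      simp [hM, Matrix.sum_apply]
    rw [hMsum, Matrix.sum_mulVec, dotProduct_sum]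
    have hl (l : Fin (n + 1)) : star (v j) ⬝ᵥ embedAt (window hN l) A *ᵥ v j =
        star (v j) ⬝ᵥ embed dloc k' (n + 1) A *ᵥ v j := by
      rw [quadForm_shift_iterate (confShift dloc (n + 1)).symm (embed dloc k' (n + 1) A) (v j)
        (τ j) (by simp [hv]) (fun x => by rw [← Tmat_mulVec dloc (n + 1) (v j) x, hτ]; rfl) l]
      simp only [embed_confShift_symm_iterate hN]
      rfl
    simp [hl]
  have hbound := (sum_norm_sq_diag_le M v hv).trans (frobenius_sum_translates_le hN A hA hle)
  simp only [hquad, norm_mul, mul_pow, Complex.norm_natCast] at hbound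
  rw [← Finset.mul_sum] at hbound
  have hd : (0 : ℝ) < (dloc : ℝ) ^ (n + 1) := by positivity
  have hn : (0 : ℝ) < ((n + 1 : ℕ) : ℝ) := by positivity
  rw [one_div, inv_mul_le_iff₀ hd, ← mul_div_assoc, le_div_iff₀ hn]
  refine le_of_mul_le_mul_left ?_ hn
  linarith
end

section
/- Let A be a traceless operator on the first k' sites. Then (1/d) tr(H_N A) is independent of N for N ≥ k + k' − 1; that is, for all N₁, N₂ ≥ k + k' − 1, tr(H_{N₁} A)/d_loc^{N₁} = tr(H_{N₂} A)/d_loc^{N₂}. -/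
open Matrix MeasureTheory Filter

/-- The operator `a` on `m` sites placed on the sites `f 0, …, f (m - 1)` of an `N`-site chain,
tensored with the identity on the remaining sites. -/
noncomputable def placeOp {dloc m N : ℕ} (f : Fin m → Fin N) (a : Op dloc m) : Op dloc N :=
  open Classical in
  fun x y => a (x ∘ f) (y ∘ f) * (if ∀ j, j ∉ Set.range f → x j = y j then 1 else 0)

theorem placeOp_succAbove_apply {dloc m N : ℕ} (p : Fin (N + 1)) (f : Fin m → Fin N)
    (a : Op dloc m) (s t : Fin dloc) (x y : Fin N → Fin dloc) :
    placeOp (p.succAbove ∘ f) a (p.insertNth s x) (p.insertNth t y) =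
      if s = t then placeOp f a x y else 0 := by
  have hc : ∀ (u : Fin dloc) (z : Fin N → Fin dloc),
      (p.insertNth u z : Fin (N + 1) → Fin dloc) ∘ (p.succAbove ∘ f) = z ∘ f := by
    intro u z
    ext i
    simp
  have hr : ∀ j, p.succAbove j ∈ Set.range (p.succAbove ∘ f) ↔ j ∈ Set.range f := by
    intro j
    simp [Set.mem_range]
  have hp : p ∉ Set.range (p.succAbove ∘ f) := by
    simp [Set.mem_range, Fin.succAbove_ne]
  unfold placeOp
  rw [hc, hc]
  simp only [Fin.forall_iff_succAbove p, hr, hp, Fin.insertNth_apply_same,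
    Fin.insertNth_apply_succAbove]
  by_cases hst : s = t <;> simp [hst]

/-- Adding an idle site multiplies the trace of a product by the local dimension. -/
theorem trace_placeOp_succAbove {dloc m m' N : ℕ} (p : Fin (N + 1)) (f : Fin m → Fin N)
    (g : Fin m' → Fin N) (a : Op dloc m) (b : Op dloc m') :
    (placeOp (p.succAbove ∘ f) a * placeOp (p.succAbove ∘ g) b).trace =
      dloc * (placeOp f a * placeOp g b).trace := by
  have hsum : ∀ F : (Fin (N + 1) → Fin dloc) → ℂ,
      ∑ x, F x = ∑ s : Fin dloc, ∑ x : Fin N → Fin dloc, F (p.insertNth s x) := by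
    intro F
    rw [← (Fin.insertNthEquiv (fun _ => Fin dloc) p).sum_comp, Fintype.sum_prod_type]
    rfl
  simp only [Matrix.trace, Matrix.diag, Matrix.mul_apply, hsum, placeOp_succAbove_apply]
  simp [ite_mul, Finset.sum_ite_irrel]

/-- Operators on disjoint sets of sites, one of them traceless, have a product of trace zero. -/
theorem trace_placeOp_mul_eq_zero {dloc m m' N : ℕ} {f : Fin m → Fin N} {g : Fin m' → Fin N}
    (hg : Function.Injective g) (hfg : ∀ i j, f i ≠ g j) (a : Op dloc m) {b : Op dloc m'}
    (hb : b.trace = 0) : (placeOp f a * placeOp g b).trace = 0 := by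
  classical
  have hdiag : ∀ x y, placeOp f a x y * placeOp g b y x =
      if x = y then a (x ∘ f) (x ∘ f) * b (x ∘ g) (x ∘ g) else 0 := by
    intro x y
    by_cases hxy : x = y
    · subst hxy
      simp [placeOp]
    · have hne : ¬ ((∀ j, j ∉ Set.range f → x j = y j) ∧ ∀ j, j ∉ Set.range g → y j = x j) := by
        rintro ⟨h1, h2⟩
        refine hxy (funext fun j => ?_)
        by_cases hj : j ∈ Set.range f
        · obtain ⟨i, rfl⟩ := hj
          exact (h2 _ (by rintro ⟨l, hl⟩; exact hfg i l hl.symm)).symm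
        · exact h1 j hj
      rw [if_neg hxy]
      unfold placeOp
      by_cases h1 : ∀ j, j ∉ Set.range f → x j = y j
      · rw [if_neg (c := ∀ j, j ∉ Set.range g → y j = x j) (fun h2 => hne ⟨h1, h2⟩)]
        simp
      · rw [if_neg h1]
        simp
  simp only [Matrix.trace, Matrix.diag, Matrix.mul_apply, hdiag, Finset.sum_ite_eq,
    Finset.mem_univ, if_true]
  rw [← (Equiv.piEquivPiSubtypeProd (· ∈ Set.range g) (fun _ => Fin dloc)).symm.sum_comp,
    Fintype.sum_prod_type_right]
  refine Finset.sum_eq_zero fun z _ => ?_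
  rw [← ((Equiv.ofInjective g hg).arrowCongr (Equiv.refl (Fin dloc))).sum_comp]
  have hf : ∀ w, (Equiv.piEquivPiSubtypeProd (· ∈ Set.range g) (fun _ => Fin dloc)).symm (w, z) ∘ f
      = fun i => z ⟨f i, by rintro ⟨j, hj⟩; exact hfg i j hj.symm⟩ := by
    intro w
    ext i
    have : ¬ ∃ y, g y = f i := by rintro ⟨j, hj⟩; exact hfg i j hj.symm
    simp [Equiv.piEquivPiSubtypeProd, this]
  have hgw : ∀ w : Fin m' → Fin dloc,
      (Equiv.piEquivPiSubtypeProd (· ∈ Set.range g) (fun _ => Fin dloc)).symm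
        ((Equiv.ofInjective g hg).arrowCongr (Equiv.refl (Fin dloc)) w, z) ∘ g = w := by
    intro w
    ext i
    simp [Equiv.piEquivPiSubtypeProd, Equiv.arrowCongr]
  simp only [hf, hgw]
  rw [← Finset.mul_sum]
  have : ∑ w, b w w = 0 := hb
  rw [this, mul_zero]

theorem embed_eq_placeOp {dloc m N : ℕ} (hm : m ≤ N) (a : Op dloc m) :
    embed dloc m N a = placeOp (Fin.castLE hm) a := by
  refine (dif_pos hm).trans ?_
  ext x y
  have hr : ∀ j : Fin N, j ∉ Set.range (Fin.castLE hm) ↔ m ≤ (j : ℕ) := by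
    intro j
    simp [Fin.range_castLE]
  simp only [placeOp, hr, Function.comp_def]

theorem Tmat_conj_apply {dloc N : ℕ} (M : Op dloc N) (x y : Fin N → Fin dloc) :
    (Tmat dloc N * M * (Tmat dloc N)ᴴ) x y = M (x ∘ finRotate N) (y ∘ finRotate N) := by
  have hs : ∀ z w : Fin N → Fin dloc, z = confShift dloc N w ↔ z ∘ finRotate N = w := by
    intro z w
    rw [← Equiv.symm_apply_eq]
    rfl
  simp [Matrix.mul_apply, Tmat, hs, apply_ite]

theorem Tmat_pow_conj_apply {dloc N : ℕ} (l : ℕ) (M : Op dloc N) (x y : Fin N → Fin dloc) :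
    (Tmat dloc N ^ l * M * (Tmat dloc N)ᴴ ^ l) x y =
      M (x ∘ (finRotate N ^ l : Equiv.Perm (Fin N)))
        (y ∘ (finRotate N ^ l : Equiv.Perm (Fin N))) := by
  induction l generalizing x y with
  | zero => simp
  | succ l ih =>
    have : Tmat dloc N ^ (l + 1) * M * (Tmat dloc N)ᴴ ^ (l + 1) =
        Tmat dloc N * (Tmat dloc N ^ l * M * (Tmat dloc N)ᴴ ^ l) * (Tmat dloc N)ᴴ := by
      rw [pow_succ', pow_succ]
      simp only [Matrix.mul_assoc]
    rw [this, Tmat_conj_apply, ih, pow_succ']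
    rfl

theorem finRotate_pow_val {N : ℕ} (l : ℕ) (i : Fin N) :
    (((finRotate N ^ l : Equiv.Perm (Fin N)) i : Fin N) : ℕ) = (i + l) % N := by
  obtain _ | n := N
  · exact i.elim0
  induction l with
  | zero => simp [Nat.mod_eq_of_lt i.isLt]
  | succ l ih =>
    rw [pow_succ', Equiv.Perm.mul_apply, finRotate_apply, Fin.val_add, ih]
    simp [Nat.add_mod, ← add_assoc]

/-- The `i`-th site of a window of length `m ≤ N` that starts at site `l` of a ring of `N` sites. -/
def windowSite {m N : ℕ} (hm : m ≤ N) (l : ℕ) (i : Fin m) : Fin N :=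
  ⟨(i + l) % N, Nat.mod_lt _ (lt_of_lt_of_le i.pos hm)⟩

theorem Tmat_pow_conj_embed {dloc m N : ℕ} (hm : m ≤ N) (a : Op dloc m) (l : ℕ) :
    Tmat dloc N ^ l * embed dloc m N a * (Tmat dloc N)ᴴ ^ l = placeOp (windowSite hm l) a := by
  have hw : windowSite hm l = (finRotate N ^ l : Equiv.Perm (Fin N)) ∘ Fin.castLE hm := by
    ext i
    simp [windowSite, finRotate_pow_val]
  ext x y
  rw [Tmat_pow_conj_apply, embed_eq_placeOp hm, hw]
  unfold placeOp
  rw [Function.comp_assoc, Function.comp_assoc]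
  congr 2
  rw [eq_iff_iff, ← (finRotate N ^ l : Equiv.Perm (Fin N)).forall_congr_right
    (q := fun j => j ∉ Set.range (_ ∘ Fin.castLE hm) → x j = y j)]
  simp only [Set.mem_range, Function.comp_apply, EmbeddingLike.apply_eq_iff_eq]

theorem trace_Ham_mul_embed {dloc k k' N : ℕ} (hkN : k ≤ N) (hkN' : k' ≤ N) (h : Op dloc k)
    (A : Op dloc k') : (Ham dloc k N h * embed dloc k' N A).trace =
      ∑ l : Fin N, (placeOp (windowSite hkN l) h * placeOp (Fin.castLE hkN') A).trace := by
  simp only [Ham, Tmat_pow_conj_embed hkN, embed_eq_placeOp hkN', Finset.sum_mul, Matrix.trace_sum]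

theorem trace_Ham_mul_embed_succ {dloc k k' N : ℕ} (hk : 1 ≤ k) (hk' : 1 ≤ k')
    (hN : k + k' - 1 ≤ N) (h : Op dloc k) {A : Op dloc k'} (hA : A.trace = 0) :
    (Ham dloc k (N + 1) h * embed dloc k' (N + 1) A).trace =
      dloc * (Ham dloc k N h * embed dloc k' N A).trace := by
  have hkN : k ≤ N := by omega
  have hkN' : k' ≤ N := by omega
  rw [trace_Ham_mul_embed (by omega : k ≤ N + 1) (by omega : k' ≤ N + 1),
    trace_Ham_mul_embed hkN hkN', Fin.sum_univ_succAbove _ (⟨k', by omega⟩ : Fin (N + 1)),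
    trace_placeOp_mul_eq_zero (Fin.castLE_injective _) _ h hA, zero_add, Finset.mul_sum]
  · refine Finset.sum_congr rfl fun l _ => ?_
    by_cases hl : (l : ℕ) < k'
    · rw [← trace_placeOp_succAbove (Fin.last N)]
      congr 3
      · ext i
        have h1 : (i : ℕ) + l < N := by omega
        have h2 : (i : ℕ) + l < N + 1 := by omega
        simp [windowSite, Fin.succAbove, Fin.lt_def, hl, Nat.mod_eq_of_lt h1, Nat.mod_eq_of_lt h2]
      · ext i
        simp
    · rw [← trace_placeOp_succAbove l.castSucc]
      congr 3
      · ext i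
        have hv : (((⟨k', by omega⟩ : Fin (N + 1)).succAbove l : Fin (N + 1)) : ℕ) = l + 1 := by
          simp [Fin.succAbove, Fin.lt_def, hl]
        simp only [windowSite, hv, Function.comp_apply]
        simp only [Fin.succAbove, Fin.lt_def]
        by_cases hw : (i : ℕ) + l < N
        · have h2 : (i : ℕ) + (l + 1) < N + 1 := by omega
          simp [Nat.mod_eq_of_lt hw, Nat.mod_eq_of_lt h2, add_assoc]
        · have e1 : ((i : ℕ) + l) % N = i + l - N := by
            rw [Nat.mod_eq_sub_mod (by omega), Nat.mod_eq_of_lt (by omega)]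
          have e2 : ((i : ℕ) + (l + 1)) % (N + 1) = i + l - N := by
            rw [Nat.mod_eq_sub_mod (by omega), Nat.mod_eq_of_lt (by omega)]
            omega
          have h3 : (i : ℕ) + l - N < l := by omega
          simp [e1, e2, h3]
      · ext i
        have : (i : ℕ) < l := by omega
        simp [Fin.succAbove, Fin.lt_def, this]
  · intro i j hij
    have hv := congrArg Fin.val hij
    simp only [windowSite, Fin.val_castLE] at hv
    rw [Nat.mod_eq_of_lt (by omega)] at hv
    omega

/-- For a traceless operator `A` on the first `k'` sites, `tr(H_N A)/d` is
independent of `N` for `N ≥ k + k' - 1`. -/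
theorem trace_HA_eventually_const (dloc k k' : ℕ) (hdloc : 2 ≤ dloc) (hk : 1 ≤ k)
    (h : Op dloc k) (hherm : h.IsHermitian) (htr : h.trace = 0) (hnorm : opNorm h = 1)
    (A : Op dloc k') (hA : A.trace = 0) :
    ∀ N₁ N₂ : ℕ, k + k' - 1 ≤ N₁ → k + k' - 1 ≤ N₂ →
      (Ham dloc k N₁ h * embed dloc k' N₁ A).trace / (dloc : ℂ) ^ N₁ =
        (Ham dloc k N₂ h * embed dloc k' N₂ A).trace / (dloc : ℂ) ^ N₂ := by
  obtain rfl | hk' := Nat.eq_zero_or_pos k'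
  · have hA0 : A = 0 := by
      ext x y
      rw [Subsingleton.elim x default, Subsingleton.elim y default]
      simpa [Matrix.trace] using hA
    intro N₁ N₂ _ _
    simp [hA0, embed_eq_placeOp (Nat.zero_le _), placeOp, Matrix.trace, Matrix.mul_apply]
  have hd : (dloc : ℂ) ≠ 0 := by
    exact_mod_cast (by omega : dloc ≠ 0)
  have hconst : ∀ N, k + k' - 1 ≤ N →
      (Ham dloc k N h * embed dloc k' N A).trace / (dloc : ℂ) ^ N =
        (Ham dloc k (k + k' - 1) h * embed dloc k' (k + k' - 1) A).trace /
          (dloc : ℂ) ^ (k + k' - 1) := by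
    intro N hN
    induction N, hN using Nat.le_induction with
    | base => rfl
    | succ N hN ih =>
      rw [trace_Ham_mul_embed_succ hk hk' hN h hA, ← ih, pow_succ']
      field_simp
  intro N₁ N₂ h₁ h₂
  rw [hconst N₁ h₁, hconst N₂ h₂]
end
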